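/- arXiv:1412.7847 — 9 statements merged into one kernel-verified Lean document; each statement's English description precedes it below -/
import Mathlib

section
/- Every acylindrically hyperbolic group G is not invariably generated; that is, there exists a proper subgroup H < G such that every element of G is conjugate in G to an element of H. -/
def IsGeodesicFrom {X : Type} [MetricSpace X] (x y : X) (γ : ℝ → X) : Prop :=
  γ 0 = x ∧ γ (dist x y) = y ∧
    ∀ s ∈ Set.Icc (0 : ℝ) (dist x y), ∀ t ∈ Set.Icc (0 : ℝ) (dist x y),
      dist (γ s) (γ t) = |s - t|

def geoImage {X : Type} [MetricSpace X] (x y : X) (γ : ℝ → X) : Set X :=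
  γ '' Set.Icc (0 : ℝ) (dist x y)

def IsGeodesicSpace (X : Type) [MetricSpace X] : Prop :=
  ∀ x y : X, ∃ γ : ℝ → X, IsGeodesicFrom x y γ

def IsDeltaHyperbolic (X : Type) [MetricSpace X] (δ : ℝ) : Prop :=
  ∀ (x y z : X) (γ₁ γ₂ γ₃ : ℝ → X),
    IsGeodesicFrom x y γ₁ → IsGeodesicFrom y z γ₂ → IsGeodesicFrom x z γ₃ →
      ∀ p ∈ geoImage x z γ₃,
        ∃ q ∈ geoImage x y γ₁ ∪ geoImage y z γ₂, dist p q ≤ δ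

def QuasiConvexSet {X : Type} [MetricSpace X] (Q : ℝ) (A : Set X) : Prop :=
  ∀ x ∈ A, ∀ y ∈ A, ∀ γ : ℝ → X, IsGeodesicFrom x y γ →
    ∀ p ∈ geoImage x y γ, ∃ a ∈ A, dist p a ≤ Q


def AcylindricalAction {G X : Type} [Group G] [MetricSpace X] (φ : G →* (X ≃ᵢ X)) : Prop :=
  ∀ R : ℝ, 0 < R → ∃ L : ℝ, 0 < L ∧ ∃ N : ℕ, ∀ v w : X, L ≤ dist v w →
    {g : G | dist v (φ g v) ≤ R ∧ dist w (φ g w) ≤ R}.Finite ∧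
    {g : G | dist v (φ g v) ≤ R ∧ dist w (φ g w) ≤ R}.ncard ≤ N

/-- `G` is virtually cyclic: it has a cyclic subgroup of finite index. -/
def IsVirtuallyCyclic (G : Type) [Group G] : Prop :=
  ∃ H : Subgroup G, IsCyclic H ∧ H.index ≠ 0

/-- `G` is acylindrically hyperbolic: `G` is not virtually cyclic and admits an
acylindrical action by isometries, with unbounded orbits, on some `δ`-hyperbolic
geodesic metric space. -/
def IsAcylindricallyHyperbolic (G : Type) [Group G] : Prop :=
  ¬ IsVirtuallyCyclic G ∧
  ∃ (X : Type) (_ : MetricSpace X) (δ : ℝ), 0 < δ ∧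
    IsGeodesicSpace X ∧ IsDeltaHyperbolic X δ ∧
    ∃ φ : G →* (X ≃ᵢ X), AcylindricalAction φ ∧
      ∃ x : X, ¬ Bornology.IsBounded (Set.range fun g : G => φ g x)


namespace AHIG

theorem exists_center {X : Type} [MetricSpace X] {δ : ℝ} (hδ : 0 < δ)
    (hX : IsDeltaHyperbolic X δ) (x w z : X) (α β γ : ℝ → X)
    (hα : IsGeodesicFrom x w α) (hβ : IsGeodesicFrom w z β) (hγ : IsGeodesicFrom x z γ) :
    ∃ p ∈ geoImage x z γ, (∃ u ∈ geoImage x w α, dist p u ≤ δ) ∧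
      (∃ v ∈ geoImage w z β, dist p v ≤ 3 * δ) := by
  classical
  set l := dist x z with hl
  have hl0 : 0 ≤ l := dist_nonneg
  let S : Set ℝ := {t | t ∈ Set.Icc (0:ℝ) l ∧ ∃ u ∈ geoImage x w α, dist (γ t) u ≤ δ}
  have h0 : (0:ℝ) ∈ S := by
    refine ⟨⟨le_rfl, hl0⟩, x, ⟨0, ⟨le_rfl, dist_nonneg⟩, hα.1⟩, ?_⟩
    rw [hγ.1, dist_self]; exact hδ.le
  have hbdd : BddAbove S := ⟨l, fun t ht => ht.1.2⟩
  obtain ⟨t1, ht1, hlt⟩ := exists_lt_of_lt_csSup ⟨0, h0⟩ (show sSup S - δ < sSup S by linarith)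
  have ht1le : t1 ≤ sSup S := le_csSup hbdd ht1
  have hSl : sSup S ≤ l := csSup_le ⟨0, h0⟩ (fun t ht => ht.1.2)
  obtain ⟨t2, ht2, hd, v, hv, hv2⟩ : ∃ t2 ∈ Set.Icc (0:ℝ) l, |t1 - t2| ≤ 2 * δ ∧
      ∃ v ∈ geoImage w z β, dist (γ t2) v ≤ δ := by
    by_cases hc : sSup S + δ ≤ l
    · have hmem : sSup S + δ ∈ Set.Icc (0:ℝ) l := ⟨by linarith [ht1.1.1], hc⟩
      refine ⟨sSup S + δ, hmem, ?_, ?_⟩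
      · rw [abs_le]; constructor <;> linarith
      · obtain ⟨q, hq, hq2⟩ := hX x w z α β γ hα hβ hγ (γ (sSup S + δ)) ⟨_, hmem, rfl⟩
        rcases hq with hq | hq
        · exfalso
          have : sSup S + δ ∈ S := ⟨hmem, q, hq, hq2⟩
          linarith [le_csSup hbdd this]
        · exact ⟨q, hq, hq2⟩
    · refine ⟨l, ⟨hl0, le_rfl⟩, ?_, z, ⟨dist w z, ⟨dist_nonneg, le_rfl⟩, hβ.2.1⟩, ?_⟩
      · rw [abs_le]; constructor <;> linarith
      · rw [hγ.2.1, dist_self]; exact hδ.le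
  refine ⟨γ t1, ⟨t1, ht1.1, rfl⟩, ht1.2, v, hv, ?_⟩
  have := hγ.2.2 t1 ht1.1 t2 ht2
  linarith [dist_triangle (γ t1) (γ t2) v]

theorem geo_add {X : Type} [MetricSpace X] {x y p : X} {γ : ℝ → X} (h : IsGeodesicFrom x y γ)
    (hp : p ∈ geoImage x y γ) : dist x p + dist p y = dist x y := by
  obtain ⟨t, ht, rfl⟩ := hp
  have h1 := h.2.2 0 ⟨le_rfl, dist_nonneg⟩ t ht
  have h2 := h.2.2 t ht (dist x y) ⟨dist_nonneg, le_rfl⟩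
  rw [h.1] at h1
  rw [h.2.1] at h2
  rw [h1, h2, abs_of_nonpos (by linarith [ht.1]), abs_of_nonpos (by linarith [ht.2])]
  ring

def FourPt {X : Type} (d : X → X → ℝ) (δ : ℝ) : Prop :=
  ∀ x y z t : X, d x y + d z t ≤ d x z + d y t + δ ∨ d x y + d z t ≤ d x t + d y z + δ

theorem fourPt_of_slim {X : Type} [MetricSpace X] {δ : ℝ} (hδ : 0 < δ)
    (hg : IsGeodesicSpace X) (hX : IsDeltaHyperbolic X δ) :
    FourPt (fun x y : X => dist x y) (10 * δ) := by
  intro x z w y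
  show dist x z + dist w y ≤ dist x w + dist z y + 10 * δ ∨
    dist x z + dist w y ≤ dist x y + dist z w + 10 * δ
  obtain ⟨α, hα⟩ := hg x w
  obtain ⟨β, hβ⟩ := hg w z
  obtain ⟨γ, hγ⟩ := hg x z
  obtain ⟨ξ, hξ⟩ := hg x y
  obtain ⟨η, hη⟩ := hg y z
  obtain ⟨p, hp, ⟨u, hu, hpu⟩, ⟨v, hv, hpv⟩⟩ := exists_center hδ hX x w z α β γ hα hβ hγ
  obtain ⟨q, hq, hpq⟩ := hX x y z ξ η γ hξ hη hγ p hp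
  have e1 := geo_add hγ hp
  have e2 := geo_add hα hu
  have e3 := geo_add hβ hv
  have a1 := dist_triangle x u p
  have a2 := dist_triangle w u p
  have a3 := dist_triangle w v p
  have a4 := dist_triangle p v z
  have a5 := dist_triangle x p u
  have a6 := dist_triangle w q p
  have a7 := dist_triangle w p q
  simp only [dist_comm] at *
  rcases hq with hq | hq
  · have e4 := geo_add hξ hq
    right
    have b1 := dist_triangle w q x
    have b2 := dist_triangle w q y
    simp only [dist_comm] at *
    linarith
  · have e4 := geo_add hη hq
    left
    have b1 := dist_triangle w q z
    have b2 := dist_triangle w q y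
    simp only [dist_comm] at *
    linarith

/-- An isometric action, unbundled. -/
structure IsoAct (G X : Type) [Group G] [MetricSpace X] (A : G → X → X) : Prop where
  one : ∀ x, A 1 x = x
  mul : ∀ g h x, A (g * h) x = A g (A h x)
  iso : ∀ g x y, dist (A g x) (A g y) = dist x y

theorem IsoAct.inv_left {G X : Type} [Group G] [MetricSpace X] {A : G → X → X}
    (hA : IsoAct G X A) (g : G) (x y : X) : dist (A g⁻¹ x) y = dist x (A g y) := by
  rw [← hA.iso g, ← hA.mul, mul_inv_cancel, hA.one]

theorem claim_one {G X : Type} [Group G] [MetricSpace X] {A : G → X → X}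
    (hA : IsoAct G X A) {δ C₁ : ℝ} (hδ : 0 < δ) (hC : 0 < C₁)
    (h4 : FourPt (fun x y : X => dist x y) δ)
    (hno : ∀ (g : G) (y : X), dist y (A (g * g) y) < dist y (A g y) + C₁) (x : X) (g h : G) :
    dist (A g x) (A h x) ≤ dist x (A g x) + (C₁ + 3 * δ) ∨
    dist (A g x) (A h x) ≤ dist x (A h x) + (C₁ + 3 * δ) := by
  by_contra! hcon
  obtain ⟨k1, k2⟩ := hcon
  have ng := hno g x
  have nh := hno h x
  have ngh := hno (g * h) x
  have ig : dist x (A g⁻¹ x) = dist x (A g x) := by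
    rw [dist_comm, hA.inv_left]
  have ih : dist x (A h⁻¹ x) = dist x (A h x) := by
    rw [dist_comm, hA.inv_left]
  have igg : dist (A g x) (A g⁻¹ x) = dist x (A (g * g) x) := by
    rw [dist_comm, hA.inv_left, hA.mul]
  have ihh : dist (A h x) (A h⁻¹ x) = dist x (A (h * h) x) := by
    rw [dist_comm, hA.inv_left, hA.mul]
  have iD : dist (A g⁻¹ x) (A h x) = dist x (A (g * h) x) := by
    rw [hA.inv_left, hA.mul]
  have iuv : dist (A (g * h) x) (A (g * h)⁻¹ x) = dist x (A (g * h * (g * h)) x) := by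
    rw [dist_comm, hA.inv_left, hA.mul (g * h)]
  have iv : dist x (A (g * h)⁻¹ x) = dist x (A (g * h) x) := by
    rw [dist_comm, hA.inv_left]
  have iug : dist (A (g * h) x) (A g x) = dist x (A h x) := by
    rw [hA.mul, hA.iso, dist_comm]
  have ivh : dist (A (g * h)⁻¹ x) (A h⁻¹ x) = dist x (A g x) := by
    rw [mul_inv_rev, hA.mul, hA.iso, dist_comm, ig]
  have q1 := h4 x (A g⁻¹ x) (A g x) (A h x)
  have q2 := h4 x (A h⁻¹ x) (A h x) (A g x)
  have q3 := h4 x (A (g * h) x) (A g x) (A (g * h)⁻¹ x)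
  have q4 := h4 x (A (g * h)⁻¹ x) (A g x) (A h⁻¹ x)
  simp only [] at q1 q2 q3 q4
  have c1 := dist_comm (A g x) (A g⁻¹ x)
  have c2 := dist_comm (A h x) (A h⁻¹ x)
  have c3 := dist_comm (A h x) (A g x)
  have c4 := dist_comm (A h⁻¹ x) (A g x)
  have c5 := dist_comm (A (g * h)⁻¹ x) (A g x)
  rcases q1 with q1 | q1 <;> rcases q2 with q2 | q2 <;> rcases q3 with q3 | q3 <;>
    rcases q4 with q4 | q4 <;> linarith

theorem pos_lemma {G X : Type} [Group G] [MetricSpace X] {A : G → X → X}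
    (hA : IsoAct G X A) {δ : ℝ} (hδ : 0 < δ)
    (h4 : FourPt (fun x y : X => dist x y) δ) (x : X) (g h : G) (M T : ℝ)
    (hg : dist x (A g x) ≤ M) (y : X) (hy : dist x y = T)
    (hyh : dist y (A h x) = dist x (A h x) - T) (hT : M + δ < T) :
    dist x (A g y) + (dist x (A h x) - T) ≤ dist x (A (g * h) x) + δ ∧
    dist x (A (g * h) x) ≤ dist x (A g y) + (dist x (A h x) - T) := by
  have e1 : dist (A g y) (A (g * h) x) = dist x (A h x) - T := by rw [hA.mul, hA.iso, hyh]
  have e2 : dist (A g x) (A (g * h) x) = dist x (A h x) := by rw [hA.mul, hA.iso]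
  have e3 : dist (A g x) (A g y) = T := by rw [hA.iso, hy]
  constructor
  · have q := h4 x (A g y) (A g x) (A (g * h) x)
    simp only [] at q
    have t1 := dist_triangle (A g x) x (A g y)
    have c1 := dist_comm (A g x) x
    have c2 := dist_comm (A g y) (A g x)
    rcases q with q | q <;> linarith
  · have t1 := dist_triangle x (A g y) (A (g * h) x)
    linarith

theorem fellow_lemma {G X : Type} [Group G] [MetricSpace X] {A : G → X → X}
    (hA : IsoAct G X A) {δ : ℝ} (hδ : 0 < δ)
    (h4 : FourPt (fun x y : X => dist x y) δ) (x : X) (g h : G) (M T C T' : ℝ)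
    (hg : dist x (A g x) ≤ M) (y : X) (hy : dist x y = T)
    (hyh : dist y (A h x) = dist x (A h x) - T) (hT : M + δ < T)
    (hc : dist (A h x) (A (g * h) x) ≤ dist x (A h x) + M + C)
    (y' : X) (hy' : dist x y' = T')
    (hyh' : dist y' (A h x) = dist x (A h x) - T')
    (hbig : 2 * T' + 2 * M + C ≤ dist x (A h x)) :
    dist y' (A g y) ≤ |T' - dist x (A g y)| + 2 * δ := by
  obtain ⟨p1, p2⟩ := pos_lemma hA hδ h4 x g h M T hg y hy hyh hT
  have e1 : dist (A g y) (A (g * h) x) = dist x (A h x) - T := by rw [hA.mul, hA.iso, hyh]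
  have e2 : dist (A g x) (A (g * h) x) = dist x (A h x) := by rw [hA.mul, hA.iso]
  have t1 : dist x (A h x) ≤ dist x (A (g * h) x) + M := by
    have := dist_triangle (A g x) x (A (g * h) x)
    have := dist_comm (A g x) x
    linarith
  have k : dist y' (A (g * h) x) ≤ dist x (A (g * h) x) - T' + δ := by
    have q := h4 x (A h x) y' (A (g * h) x)
    simp only [] at q
    have c2 := dist_comm (A h x) y'
    rcases q with q | q <;> linarith
  have q := h4 x (A (g * h) x) y' (A g y)
  simp only [] at q
  have c1 := dist_comm (A (g * h) x) y'
  have c2 := dist_comm (A (g * h) x) (A g y)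
  have m1 := le_abs_self (T' - dist x (A g y))
  have m2 := neg_abs_le (T' - dist x (A g y))
  rcases q with q | q <;> linarith

theorem exists_on_geo {X : Type} [MetricSpace X] (hg : IsGeodesicSpace X) (x z : X) : ∃ γ : ℝ → X, ∀ T, 0 ≤ T → T ≤ dist x z →
      dist x (γ T) = T ∧ dist (γ T) z = dist x z - T ∧
      ∀ T', 0 ≤ T' → T' ≤ dist x z → dist (γ T) (γ T') = |T - T'| := by
  obtain ⟨γ, hγ⟩ := hg x z
  refine ⟨γ, fun T h0 h1 => ⟨?_, ?_, ?_⟩⟩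
  · have := hγ.2.2 0 ⟨le_rfl, dist_nonneg⟩ T ⟨h0, h1⟩
    rw [hγ.1] at this
    rw [this, zero_sub, abs_neg, abs_of_nonneg h0]
  · have := hγ.2.2 T ⟨h0, h1⟩ _ ⟨dist_nonneg, le_rfl⟩
    rw [hγ.2.1] at this
    rw [this, abs_of_nonpos (by linarith)]; ring
  · intro T' h0' h1'
    exact hγ.2.2 T ⟨h0, h1⟩ T' ⟨h0', h1'⟩

theorem small_disp {G X : Type} [Group G] [MetricSpace X] {A : G → X → X}
    (hA : IsoAct G X A) {δ C₁ : ℝ} (hδ : 0 < δ) (hC : 0 < C₁)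
    (h4 : FourPt (fun x y : X => dist x y) δ)
    (hno : ∀ (g : G) (y : X), dist y (A (g * g) y) < dist y (A g y) + C₁)
    (x : X) (g h : G) (γ : ℝ → X)
    (hγ : ∀ T, 0 ≤ T → T ≤ dist x (A h x) →
      dist x (γ T) = T ∧ dist (γ T) (A h x) = dist x (A h x) - T)
    (M T : ℝ) (hg : dist x (A g x) ≤ M) (hT : 2 * M + δ < T)
    (hbig : 2 * T + 4 * M + (C₁ + 3 * δ) ≤ dist x (A h x)) :
    dist (γ T) (A g (γ T)) ≤ C₁ + 10 * δ := by
  have hM : 0 ≤ M := le_trans dist_nonneg hg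
  have hc : dist (A h x) (A (g * h) x) ≤ dist x (A h x) + M + (C₁ + 3 * δ) := by
    have e2 : dist (A g x) (A (g * h) x) = dist x (A h x) := by rw [hA.mul, hA.iso]
    have t := dist_triangle x (A g x) (A (g * h) x)
    rcases claim_one hA hδ hC h4 hno x h (g * h) with q | q <;> linarith
  obtain ⟨y1, y2⟩ := hγ T (by linarith) (by linarith)
  set y := γ T with hy
  have P := pos_lemma hA hδ h4 x g h M T hg y y1 y2 (by linarith)
  have b1 : dist x (A g y) ≤ T + M := by
    have := dist_triangle x (A g x) (A g y)
    rw [hA.iso, y1] at this; linarith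
  have b2 : T - M ≤ dist x (A g y) := by
    have := dist_triangle (A g x) x (A g y)
    rw [hA.iso, y1, dist_comm] at this; linarith
  set a := dist x (A g y) with ha
  obtain ⟨z1, z2⟩ := hγ a (by linarith) (by linarith)
  set z := γ a with hz
  have F1 := fellow_lemma hA hδ h4 x g h M T _ T hg y y1 y2 (by linarith) hc y y1 y2 (by linarith)
  have F2 := fellow_lemma hA hδ h4 x g h M T _ a hg y y1 y2 (by linarith) hc z z1 z2 (by linarith)
  rw [← ha, sub_self, abs_zero, zero_add] at F2
  have P2 := pos_lemma hA hδ h4 x g h M a hg z z1 z2 (by linarith)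
  have e : dist (A g z) (A (g * g) y) ≤ 2 * δ := by rw [hA.mul, hA.iso]; exact F2
  have n := hno g y
  have t1 := dist_triangle x (A g z) (A (g * g) y)
  have t2 := dist_triangle x (A (g * g) y) (A g z)
  have t3 := dist_triangle x y (A (g * g) y)
  have t4 := dist_triangle x (A (g * g) y) y
  have c1 := dist_comm (A g z) (A (g * g) y)
  have c2 := dist_comm y (A (g * g) y)
  rw [← ha] at F1
  rcases abs_cases (T - a) with ⟨k, _⟩ | ⟨k, _⟩ <;> rw [k] at F1 <;> linarith [P.1, P.2, P2.1, P2.2]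

theorem exists_lox {G X : Type} [Group G] [MetricSpace X] {A : G → X → X}
    (hA : IsoAct G X A) {δ C₁ : ℝ} (hδ : 0 < δ) (hC : 0 < C₁)
    (h4 : FourPt (fun x y : X => dist x y) δ) (hgeo : IsGeodesicSpace X)
    (hac : ∀ R : ℝ, 0 < R → ∃ L : ℝ, 0 < L ∧ ∃ N : ℕ, ∀ v w : X, L ≤ dist v w →
      {g : G | dist v (A g v) ≤ R ∧ dist w (A g w) ≤ R}.Finite ∧
      {g : G | dist v (A g v) ≤ R ∧ dist w (A g w) ≤ R}.ncard ≤ N)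
    (x : X) (hub : ∀ B : ℝ, ∃ g : G, B < dist x (A g x)) :
    ∃ (g : G) (y : X), dist y (A g y) + C₁ ≤ dist y (A (g * g) y) := by
  by_contra! hno
  obtain ⟨L, hL, N, hN⟩ := hac (C₁ + 10 * δ) (by linarith)
  have hinf : Infinite G := by
    by_contra hfin
    rw [not_infinite_iff_finite] at hfin
    obtain ⟨B, hB⟩ := (Set.finite_range (fun g : G => dist x (A g x))).bddAbove
    obtain ⟨g, hg⟩ := hub B
    linarith [hB ⟨g, rfl⟩]
  obtain ⟨s, hs⟩ := Infinite.exists_subset_card_eq G (N + 1)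
  obtain ⟨M, hM⟩ := (s.finite_toSet.image (fun g : G => dist x (A g x))).bddAbove
  obtain ⟨h, hh⟩ := hub (2 * (2 * |M| + δ + 1 + L) + 4 * |M| + (C₁ + 3 * δ))
  have hM0 := abs_nonneg M
  obtain ⟨γ, hγ⟩ := exists_on_geo hgeo x (A h x)
  have hd := (hγ (2 * |M| + δ + 1) (by linarith) (by linarith)).2.2 (2 * |M| + δ + 1 + L)
    (by linarith) (by linarith)
  obtain ⟨hf, hcard⟩ := hN (γ (2 * |M| + δ + 1)) (γ (2 * |M| + δ + 1 + L)) (by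
    rw [hd, abs_of_nonpos (by linarith)]; linarith)
  have hsub : (s : Set G) ⊆ {g : G | dist (γ (2 * |M| + δ + 1)) (A g (γ (2 * |M| + δ + 1))) ≤ C₁ + 10 * δ ∧
      dist (γ (2 * |M| + δ + 1 + L)) (A g (γ (2 * |M| + δ + 1 + L))) ≤ C₁ + 10 * δ} := by
    intro g hg
    have hgM : dist x (A g x) ≤ |M| := le_trans (hM ⟨g, hg, rfl⟩) (le_abs_self M)
    exact ⟨small_disp hA hδ hC h4 hno x g h γ (fun T a b => ⟨(hγ T a b).1, (hγ T a b).2.1⟩) |M| _ hgM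
        (by linarith) (by linarith),
      small_disp hA hδ hC h4 hno x g h γ (fun T a b => ⟨(hγ T a b).1, (hγ T a b).2.1⟩) |M| _ hgM
        (by linarith) (by linarith)⟩
  have := Set.ncard_le_ncard hsub hf
  rw [Set.ncard_coe_finset, hs] at this
  omega

/-- Left-invariant hyperbolic pseudo-metric on a group with the acylindricity property. -/
structure GMet {G : Type} [Group G] (d : G → G → ℝ) (δ : ℝ) : Prop where
  self : ∀ x, d x x = 0
  comm : ∀ x y, d x y = d y x
  tri : ∀ x y z, d x z ≤ d x y + d y z
  inv : ∀ g x y, d (g * x) (g * y) = d x y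
  pos : 0 < δ
  four : FourPt d δ
  acyl : ∀ R : ℝ, 0 < R → ∃ L : ℝ, 0 < L ∧ ∃ N : ℕ, ∀ v w : G, L ≤ d v w →
      {g : G | d v (g * v) ≤ R ∧ d w (g * w) ≤ R}.Finite ∧
      {g : G | d v (g * v) ≤ R ∧ d w (g * w) ≤ R}.ncard ≤ N

def Lox {G : Type} [Group G] (d : G → G → ℝ) (δ : ℝ) (w : G) : Prop :=
  d 1 w + (2 * δ + 1) ≤ d 1 (w * w)

section Lines

variable {G : Type} [Group G] {d : G → G → ℝ} {δ : ℝ}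

theorem GMet.nonneg (hd : GMet d δ) (x y : G) : 0 ≤ d x y := by
  have := hd.tri x y x
  rw [hd.self, hd.comm y x] at this
  linarith

theorem GMet.inv' (hd : GMet d δ) (g x y : G) : d (g⁻¹ * x) y = d x (g * y) := by
  rw [← hd.inv g, mul_inv_cancel_left]

theorem GMet.inv_one (hd : GMet d δ) (g : G) : d 1 g⁻¹ = d 1 g := by
  rw [← hd.inv g, mul_one, mul_inv_cancel, hd.comm]

theorem GMet.pow_sub (hd : GMet d δ) (u : G) (m n : ℕ) : d (u ^ m) (u ^ (m + n)) = d 1 (u ^ n) := by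
  rw [pow_add]
  nth_rewrite 1 [← mul_one (u ^ m)]
  rw [hd.inv]

theorem Lox.inv (hd : GMet d δ) {w : G} (hw : Lox d δ w) : Lox d δ w⁻¹ := by
  unfold Lox at *
  rw [hd.inv_one, ← mul_inv_rev, hd.inv_one]
  exact hw

theorem inv_pow_len (hd : GMet d δ) (w : G) (n : ℕ) : d 1 (w⁻¹ ^ n) = d 1 (w ^ n) := by
  rw [inv_pow, hd.inv_one]

theorem Lox.step (hd : GMet d δ) {w : G} (hw : Lox d δ w) (n : ℕ) :
    d 1 (w ^ n) + (δ + 1) ≤ d 1 (w ^ (n + 1)) := by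
  have hδ := hd.pos
  unfold Lox at hw
  have h2 : d 1 (w * w) ≤ d 1 w + d 1 w := by
    have := hd.tri 1 w (w * w)
    have e := hd.inv w 1 w
    rw [mul_one] at e
    linarith
  induction n with
  | zero => rw [pow_zero, hd.self, zero_add, pow_one]; linarith
  | succ n ih =>
    have q := hd.four 1 (w ^ (n + 1)) (w ^ n) (w ^ (n + 1 + 1))
    have e1 := hd.pow_sub w n 2
    have e2 := hd.pow_sub w (n + 1) 1
    have e3 := hd.pow_sub w n 1
    have e4 := hd.comm (w ^ (n + 1)) (w ^ n)
    rw [pow_one] at e2 e3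
    rw [pow_two] at e1
    rw [show n + 1 + 1 = n + 2 by ring] at *
    rcases q with q | q <;> linarith

theorem Lox.len_ge (hd : GMet d δ) {w : G} (hw : Lox d δ w) (n : ℕ) : (n : ℝ) ≤ d 1 (w ^ n) := by
  induction n with
  | zero => simp [hd.self]
  | succ n ih =>
    have := hw.step hd n
    have := hd.pos
    push_cast
    linarith

theorem len_le (hd : GMet d δ) (w : G) (n : ℕ) : d 1 (w ^ n) ≤ n * d 1 w := by
  induction n with
  | zero => simp [hd.self]
  | succ n ih =>
    have := hd.tri 1 (w ^ n) (w ^ (n + 1))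
    have e := hd.pow_sub w n 1
    rw [pow_one] at e
    push_cast
    linarith

theorem Lox.add (hd : GMet d δ) {w : G} (hw : Lox d δ w) (m n : ℕ) :
    d 1 (w ^ m) + d 1 (w ^ n) ≤ d 1 (w ^ (m + n)) + (d 1 w + δ) := by
  have hδ := hd.pos
  rcases n with _ | n
  · simp only [pow_zero, hd.self, add_zero]
    linarith [hd.nonneg 1 w]
  · have q := hd.four 1 (w ^ (m + 1)) (w ^ m) (w ^ (m + (n + 1)))
    have e1 := hd.pow_sub w m (n + 1)
    have e2 := hd.pow_sub w (m + 1) n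
    have e3 := hd.pow_sub w m 1
    have e4 := hd.comm (w ^ (m + 1)) (w ^ m)
    rw [pow_one] at e3
    rw [show m + 1 + n = m + (n + 1) by ring] at e2
    have s1 := hw.step hd m
    have s2 := hw.step hd n
    rcases q with q | q <;> linarith

theorem Lox.near (hd : GMet d δ) {w : G} (hw : Lox d δ w) (z : G) (k : ℕ) (D : ℝ)
    (h : d 1 z + d z (w ^ k) ≤ d 1 (w ^ k) + D) :
    ∃ i ≤ k, d z (w ^ i) ≤ D + 2 * d 1 w + 2 * δ := by
  classical
  have hδ := hd.pos
  have hl := hd.nonneg 1 w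
  obtain ⟨i, hik, hi, hi2⟩ : ∃ i ≤ k, d 1 (w ^ i) ≤ d 1 z ∧ (i = k ∨ d 1 z ≤ d 1 (w ^ (i + 1))) := by
    have key : ∀ j ≤ k, ∃ i ≤ j, d 1 (w ^ i) ≤ d 1 z ∧ (i = j ∨ d 1 z ≤ d 1 (w ^ (i + 1))) := by
      intro j
      induction j with
      | zero => intro _; exact ⟨0, le_rfl, by rw [pow_zero, hd.self]; exact hd.nonneg _ _, Or.inl rfl⟩
      | succ j ih =>
        intro hj
        obtain ⟨i, h1, h2, h3⟩ := ih (by omega)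
        rcases h3 with h3 | h3
        · subst h3
          by_cases hc : d 1 (w ^ (i + 1)) ≤ d 1 z
          · exact ⟨i + 1, le_rfl, hc, Or.inl rfl⟩
          · exact ⟨i, by omega, h2, Or.inr (by linarith)⟩
        · exact ⟨i, by omega, h2, Or.inr h3⟩
    exact key k le_rfl
  refine ⟨i, hik, ?_⟩
  obtain ⟨r, rfl⟩ := Nat.exists_eq_add_of_le hik
  have ha := hw.add hd i r
  have e1 := hd.pow_sub w i r
  have q := hd.four z (w ^ i) 1 (w ^ (i + r))
  have c1 := hd.comm z 1
  have c2 := hd.comm (w ^ i) 1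
  have hD : 0 ≤ D := by linarith [hd.tri 1 z (w ^ (i + r))]
  have hz : d 1 z ≤ d 1 (w ^ i) + d 1 w + D := by
    rcases hi2 with hi2 | hi2
    · have := hd.nonneg z (w ^ (i + r))
      rw [← hi2] at h this; linarith
    · have e := hd.pow_sub w i 1
      rw [pow_one] at e
      linarith [hd.tri 1 (w ^ i) (w ^ (i + 1))]
  by_cases hir : d 1 z ≤ d 1 (w ^ i) + d 1 w
  · rcases q with q | q <;> linarith
  · have hr : r = 0 := by
      rcases hi2 with hi2 | hi2
      · omega
      · exfalso
        have e := hd.pow_sub w i 1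
        rw [pow_one] at e
        linarith [hd.tri 1 (w ^ i) (w ^ (i + 1))]
    subst hr
    rw [add_zero] at h
    linarith [hd.nonneg 1 (w ^ i)]

theorem fellow (hd : GMet d δ) {u v : G} (hu : Lox d δ u) (hv : Lox d δ v)
    (huv : ∀ m : ℕ, d 1 (u ^ m) = d 1 (v ^ m)) (f : G) (c : ℝ) (n n' m : ℕ)
    (hf : d 1 f ≤ c) (h : d (u ^ n) (f * v ^ n') ≤ c) (hm : m ≤ n) (hm' : m ≤ n') :
    d (u ^ m) (f * v ^ m) ≤ 3 * c + (d 1 u + 2 * δ) := by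
  obtain ⟨r, rfl⟩ := Nat.exists_eq_add_of_le hm
  obtain ⟨s, rfl⟩ := Nat.exists_eq_add_of_le hm'
  have hδ := hd.pos
  have hc : 0 ≤ c := le_trans (hd.nonneg _ _) hf
  have q := hd.four (u ^ m) (f * v ^ m) 1 (u ^ (m + r))
  have a1 := hu.add hd m r
  have a2 := hv.add hd m s
  have e1 := hd.pow_sub u m r
  have e2 : d (f * v ^ m) (f * v ^ (m + s)) = d 1 (v ^ s) := by rw [hd.inv, hd.pow_sub]
  have e3 : d f (f * v ^ m) = d 1 (v ^ m) := by
    have := hd.inv f 1 (v ^ m); rwa [mul_one] at this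
  have e4 : d f (f * v ^ (m + s)) = d 1 (v ^ (m + s)) := by
    have := hd.inv f 1 (v ^ (m + s)); rwa [mul_one] at this
  have t1 := hd.tri 1 f (f * v ^ m)
  have t2 := hd.tri (f * v ^ m) (f * v ^ (m + s)) (u ^ (m + r))
  have t3 := hd.tri f 1 (f * v ^ (m + s))
  have t4 := hd.tri 1 (u ^ (m + r)) (f * v ^ (m + s))
  have c1 := hd.comm f 1
  have c2 := hd.comm (f * v ^ (m + s)) (u ^ (m + r))
  have c3 := hd.comm (u ^ m) 1
  have c4 := hd.comm (f * v ^ m) 1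
  have g1 := huv m
  have g2 := huv 1
  rw [pow_one, pow_one] at g2
  rcases q with q | q <;> linarith

theorem overlap (hd : GMet d δ) {w : G} (hw : Lox d δ w) (c : ℝ) (hc : 0 ≤ c) :
    ∃ N T : ℕ, ∀ u v : G, (u = w ∨ u = w⁻¹) → (v = w ∨ v = w⁻¹) → ∀ (f : G) (n n' : ℕ),
      d 1 f ≤ c → T ≤ n → T ≤ n' → d (u ^ n) (f * v ^ n') ≤ c →
      ∃ e, 1 ≤ e ∧ e ≤ N ∧ f * v ^ e * f⁻¹ = u ^ e := by
  classical
  have hδ := hd.pos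
  have hl := hd.nonneg 1 w
  set R := 2 * (3 * c + (d 1 w + 2 * δ)) with hR
  obtain ⟨L, hL, N, hN⟩ := hd.acyl R (by linarith)
  obtain ⟨s, hs⟩ := exists_nat_ge L
  refine ⟨N, N + s, ?_⟩
  intro u v hu hv f n n' hf hn hn' h
  have lu : Lox d δ u := by rcases hu with rfl | rfl; exacts [hw, hw.inv hd]
  have lv : Lox d δ v := by rcases hv with rfl | rfl; exacts [hw, hw.inv hd]
  have eu : ∀ m : ℕ, d 1 (u ^ m) = d 1 (w ^ m) := by
    intro m; rcases hu with rfl | rfl; exacts [rfl, inv_pow_len hd _ _]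
  have ev : ∀ m : ℕ, d 1 (v ^ m) = d 1 (w ^ m) := by
    intro m; rcases hv with rfl | rfl; exacts [rfl, inv_pow_len hd _ _]
  have eu1 : d 1 u = d 1 w := by have := eu 1; rwa [pow_one, pow_one] at this
  have key : ∀ m ≤ N + s, d (u ^ m) (f * v ^ m) ≤ 3 * c + (d 1 w + 2 * δ) := by
    intro m hm
    rw [← eu1]
    exact fellow hd lu lv (fun m => by rw [eu, ev]) f c n n' m hf h (by omega) (by omega)
  have disp : ∀ k ≤ N, ∀ m ≤ N + s, N ≤ m →
      d (u ^ m) ((f * v ^ k * f⁻¹ * (u ^ k)⁻¹) * u ^ m) ≤ R := by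
    intro k hk m hm hNm
    obtain ⟨r, rfl⟩ := Nat.exists_eq_add_of_le (hk.trans hNm)
    have e1 : (f * v ^ k * f⁻¹ * (u ^ k)⁻¹) * u ^ (k + r) = (f * v ^ k * f⁻¹) * u ^ r := by
      rw [pow_add]; group
    have e2 : f * v ^ (k + r) = (f * v ^ k * f⁻¹) * (f * v ^ r) := by
      rw [pow_add]; group
    have t := hd.tri (u ^ (k + r)) (f * v ^ (k + r)) ((f * v ^ k * f⁻¹) * u ^ r)
    have k1 := key (k + r) hm
    have k2 := key r (by omega)
    rw [e1]
    have e3 : d (f * v ^ (k + r)) ((f * v ^ k * f⁻¹) * u ^ r) = d (u ^ r) (f * v ^ r) := by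
      rw [e2, hd.inv, hd.comm]
    linarith
  obtain ⟨hfin, hcard⟩ := hN (u ^ N) (u ^ (N + s)) (by
    rw [hd.pow_sub]
    linarith [lu.len_ge hd s])
  rw [Set.ncard_eq_toFinset_card _ hfin] at hcard
  obtain ⟨k, hk, k', hk', hne, heq⟩ := Finset.exists_ne_map_eq_of_card_lt_of_maps_to
    (s := Finset.range (N + 1)) (t := hfin.toFinset)
    (f := fun k => f * v ^ k * f⁻¹ * (u ^ k)⁻¹) (by rw [Finset.card_range]; omega) (by
      intro k hk
      have hk := Finset.mem_range.1 (Finset.mem_coe.1 hk)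
      rw [Set.Finite.coe_toFinset]
      exact ⟨disp k (by omega) N (by omega) le_rfl, disp k (by omega) (N + s) le_rfl (by omega)⟩)
  rw [Finset.mem_range] at hk hk'
  have main : ∀ k k' : ℕ, k < k' → k' < N + 1 →
      f * v ^ k * f⁻¹ * (u ^ k)⁻¹ = f * v ^ k' * f⁻¹ * (u ^ k')⁻¹ →
      ∃ e, 1 ≤ e ∧ e ≤ N ∧ f * v ^ e * f⁻¹ = u ^ e := by
    intro k k' hlt hk' heq
    obtain ⟨e, rfl⟩ := Nat.exists_eq_add_of_lt hlt
    refine ⟨e + 1, by omega, by omega, ?_⟩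
    rw [show k + e + 1 = k + (e + 1) by ring] at heq
    rw [pow_add v k, pow_add u k, mul_inv_rev] at heq
    have h1 : f⁻¹ * (u ^ k)⁻¹ = v ^ (e + 1) * f⁻¹ * ((u ^ (e + 1))⁻¹ * (u ^ k)⁻¹) := by
      have : (f * v ^ k) * (f⁻¹ * (u ^ k)⁻¹) =
        (f * v ^ k) * (v ^ (e + 1) * f⁻¹ * ((u ^ (e + 1))⁻¹ * (u ^ k)⁻¹)) := by
        simpa only [mul_assoc] using heq
      exact mul_left_cancel this
    have h2 : f⁻¹ = v ^ (e + 1) * f⁻¹ * (u ^ (e + 1))⁻¹ := by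
      rw [← mul_assoc] at h1
      exact mul_right_cancel h1
    calc f * v ^ (e + 1) * f⁻¹ = f * (v ^ (e + 1) * f⁻¹ * (u ^ (e + 1))⁻¹) * u ^ (e + 1) := by group
      _ = u ^ (e + 1) := by rw [← h2]; group
  rcases lt_or_gt_of_ne hne with hlt | hlt
  · exact main k k' hlt hk' heq
  · exact main k' k hlt hk heq.symm

end Lines

theorem conj_zpow_zpow {G : Type} [Group G] {f w : G} {m m' : ℤ} (h : f * w ^ m * f⁻¹ = w ^ m') (k : ℤ) :
    f * w ^ (m * k) * f⁻¹ = w ^ (m' * k) := by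
  rw [zpow_mul, zpow_mul, ← h, conj_zpow]

/-- The elementary closure of `w`. -/
def Esub {G : Type} [Group G] (w : G) : Subgroup G where
  carrier := {f | ∃ m : ℤ, 0 < m ∧ (f * w ^ m * f⁻¹ = w ^ m ∨ f * w ^ m * f⁻¹ = w ^ (-m))}
  one_mem' := ⟨1, by norm_num, Or.inl (by simp)⟩
  mul_mem' := by
    rintro a b ⟨m, hm, h⟩ ⟨n, hn, h'⟩
    refine ⟨m * n, by positivity, ?_⟩
    have e : ∀ x : G, (a * b) * x * (a * b)⁻¹ = a * (b * x * b⁻¹) * a⁻¹ := by intro x; group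
    rw [e]
    rcases h' with h' | h'
    · have h2 := conj_zpow_zpow h' m
      rw [mul_comm n m] at h2
      rw [h2]
      rcases h with h | h
      · exact Or.inl (conj_zpow_zpow h n)
      · right; rw [conj_zpow_zpow h n]; congr 1; ring
    · have h2 := conj_zpow_zpow h' m
      rw [mul_comm n m] at h2
      rw [h2, show -n * m = m * (-n) by ring]
      rcases h with h | h
      · right; rw [conj_zpow_zpow h (-n)]; congr 1; ring
      · left; rw [conj_zpow_zpow h (-n)]; congr 1; ring
  inv_mem' := by
    rintro a ⟨m, hm, h⟩
    refine ⟨m, hm, ?_⟩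
    rcases h with h | h
    · left; nth_rewrite 1 [← h]; group
    · right
      have h2 := conj_zpow_zpow h (-1)
      rw [show -m * -1 = m by ring] at h2
      rw [← h2]; group

section Elem

variable {G : Type} [Group G] {d : G → G → ℝ} {δ : ℝ}

theorem mem_Esub_nat {w f : G} (h : f ∈ Esub w) :
    ∃ u, (u = w ∨ u = w⁻¹) ∧ ∃ m : ℕ, 0 < m ∧ ∀ k : ℕ, f * w ^ (m * k) * f⁻¹ = u ^ (m * k) := by
  obtain ⟨m, hm, h⟩ := h
  lift m to ℕ using hm.le
  rcases h with h | h
  · refine ⟨w, Or.inl rfl, m, by exact_mod_cast hm, fun k => ?_⟩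
    have := conj_zpow_zpow h k
    exact_mod_cast this
  · refine ⟨w⁻¹, Or.inr rfl, m, by exact_mod_cast hm, fun k => ?_⟩
    have := conj_zpow_zpow h k
    rw [show -(m:ℤ) * k = -((m * k : ℕ) : ℤ) by push_cast; ring, zpow_neg, ← inv_zpow] at this
    exact_mod_cast this

theorem mem_Esub_of {w f u v : G} (hu : u = w ∨ u = w⁻¹) (hv : v = w ∨ v = w⁻¹) (e : ℕ) (he : 1 ≤ e)
    (h : f * v ^ e * f⁻¹ = u ^ e) : f ∈ Esub w := by
  have h1 : ((f * v ^ e * f⁻¹ : G))⁻¹ = (u ^ e)⁻¹ := by rw [h]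
  have h2 : f * (v ^ e)⁻¹ * f⁻¹ = (u ^ e)⁻¹ := by rw [← h1]; group
  refine ⟨e, by exact_mod_cast he, ?_⟩
  rcases hu with rfl | rfl <;> rcases hv with rfl | rfl
  · left; exact_mod_cast h
  · right; simpa using h2
  · right; simpa using h
  · left; simpa using h2

theorem self_mem_Esub (w : G) : w ∈ Esub w := ⟨1, by norm_num, Or.inl (by simp)⟩

theorem lox_pm (hd : GMet d δ) {w u : G} (hw : Lox d δ w) (hu : u = w ∨ u = w⁻¹) : Lox d δ u := by
  rcases hu with rfl | rfl; exacts [hw, hw.inv hd]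

theorem len_pm (hd : GMet d δ) {w u : G} (hu : u = w ∨ u = w⁻¹) (m : ℕ) : d 1 (u ^ m) = d 1 (w ^ m) := by
  rcases hu with rfl | rfl; exacts [rfl, inv_pow_len hd _ _]

theorem len_pm1 (hd : GMet d δ) {w u : G} (hu : u = w ∨ u = w⁻¹) : d 1 u = d 1 w := by
  have := len_pm hd hu 1
  rwa [pow_one, pow_one] at this

theorem E_near (hd : GMet d δ) {w : G} (hw : Lox d δ w) {e : G} (he : e ∈ Esub w) :
    ∃ u, (u = w ∨ u = w⁻¹) ∧ ∃ n : ℕ, d e (u ^ n) ≤ 3 * d 1 w + 5 * δ := by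
  have hδ := hd.pos
  obtain ⟨u, hu, m, hm, hk⟩ := mem_Esub_nat he
  obtain ⟨k, hkk⟩ := exists_nat_gt (3 * d 1 e + 2 * δ)
  set N := m * k with hN
  have hNk : (k : ℝ) ≤ N := by
    have : k ≤ N := Nat.le_mul_of_pos_left k hm
    exact_mod_cast this
  have hc := hk k
  rw [← hN] at hc
  have hc1 : e * w ^ N = u ^ N * e := by rw [← hc]; group
  have hc2 : e * (w ^ N)⁻¹ = (u ^ N)⁻¹ * e := by rw [← hc]; group
  have lu := lox_pm hd hw hu
  have aw := len_pm hd hu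
  have q1 := hd.four e (u ^ N) (e * (w ^ N)⁻¹) (e * w ^ N)
  have q2 := hd.four e (u ^ N)⁻¹ (e * (w ^ N)⁻¹) (u ^ N)
  have e1 : d e (e * w ^ N) = d 1 (w ^ N) := by
    have := hd.inv e 1 (w ^ N); rwa [mul_one] at this
  have e2 : d e (e * (w ^ N)⁻¹) = d 1 (w ^ N) := by
    have := hd.inv e 1 (w ^ N)⁻¹; rwa [mul_one, hd.inv_one] at this
  have e3 : d (u ^ N) (e * w ^ N) = d 1 e := by
    have := hd.inv (u ^ N) 1 e; rwa [mul_one, ← hc1] at this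
  have e4 : d (u ^ N)⁻¹ (e * (w ^ N)⁻¹) = d 1 e := by
    have := hd.inv (u ^ N)⁻¹ 1 e; rwa [mul_one, ← hc2] at this
  have e5 : d (e * (w ^ N)⁻¹) (e * w ^ N) = d 1 (w ^ (N + N)) := by
    rw [hd.inv, ← mul_one (w ^ N)⁻¹, hd.inv', pow_add]
  have e6 : d (u ^ N)⁻¹ (u ^ N) = d 1 (w ^ (N + N)) := by
    rw [← aw, ← mul_one (u ^ N)⁻¹, hd.inv', pow_add]
  have ad := hw.add hd N N
  have gN := hw.len_ge hd N
  have gNN := hw.len_ge hd (N + N)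
  push_cast at gNN
  have e7 : d 1 (u ^ N) = d 1 (w ^ N) := aw N
  have e8 : d 1 (u ^ N)⁻¹ = d 1 (w ^ N) := by rw [hd.inv_one, aw]
  have ne := hd.nonneg 1 e
  have c1 := hd.comm (u ^ N) (e * (w ^ N)⁻¹)
  have c2 := hd.comm e 1
  have c3 := hd.comm (u ^ N)⁻¹ (e * (w ^ N)⁻¹)
  have t1 := hd.tri 1 e (u ^ N)
  have t2 := hd.tri 1 e (u ^ N)⁻¹
  have t3 := hd.tri e 1 (u ^ N)
  have t4 := hd.tri (u ^ N)⁻¹ (e * (w ^ N)⁻¹) (u ^ N)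
  have s1 : d e (u ^ N) + d 1 (w ^ (N + N)) ≤ d 1 (w ^ N) + d (u ^ N) (e * (w ^ N)⁻¹) + δ := by
    rcases q1 with q1 | q1 <;> linarith
  have s2 : d e (u ^ N)⁻¹ + d (u ^ N) (e * (w ^ N)⁻¹) ≤ d 1 (w ^ N) + d 1 (w ^ (N + N)) + δ := by
    rcases q2 with q2 | q2 <;> linarith
  have f1 : d 1 (u ^ N * e) = d e (u ^ N)⁻¹ := by
    rw [← hd.inv', mul_one, hd.comm]
  have f2 : d (u ^ N * e) (u ^ (N + N)) = d e (u ^ N) := by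
    rw [pow_add, hd.inv]
  obtain ⟨i, hi, hin⟩ := lu.near hd (u ^ N * e) (N + N) (d 1 w + 3 * δ) (by
    rw [f1, f2, aw]; linarith)
  have hin' : d e ((u ^ N)⁻¹ * u ^ i) ≤ 3 * d 1 w + 5 * δ := by
    rw [hd.comm, hd.inv', hd.comm]
    have := len_pm1 hd hu
    linarith
  rcases le_total N i with h | h
  · obtain ⟨r, rfl⟩ := Nat.exists_eq_add_of_le h
    refine ⟨u, hu, r, ?_⟩
    rwa [pow_add, inv_mul_cancel_left] at hin'
  · obtain ⟨r, hr⟩ := Nat.exists_eq_add_of_le h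
    refine ⟨u⁻¹, by rcases hu with rfl | rfl <;> simp, r, ?_⟩
    rw [hr, pow_add, mul_inv_rev, inv_mul_cancel_right, ← inv_pow] at hin'
    exact hin'

theorem pm_mem_Esub {w u : G} (hu : u = w ∨ u = w⁻¹) (n : ℕ) : u ^ n ∈ Esub w := by
  apply Subgroup.pow_mem
  rcases hu with rfl | rfl
  · exact self_mem_Esub u
  · exact Subgroup.inv_mem _ (self_mem_Esub w)

/-- uniform exponent -/
theorem E_unif (hd : GMet d δ) {w : G} (hw : Lox d δ w) :
    ∃ M : ℕ, 0 < M ∧ ∀ e ∈ Esub w, e * w ^ M * e⁻¹ = w ^ M ∨ e * w ^ M * e⁻¹ = (w ^ M)⁻¹ := by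
  have hδ := hd.pos
  have hl := hd.nonneg 1 w
  obtain ⟨N, T, hNT⟩ := overlap hd hw (3 * d 1 w + 5 * δ) (by linarith)
  refine ⟨N.factorial, Nat.factorial_pos N, ?_⟩
  intro e he
  obtain ⟨u0, hu0, n, hn⟩ := E_near hd hw he
  have hf : (u0 ^ n)⁻¹ * e ∈ Esub w := Subgroup.mul_mem _ (Subgroup.inv_mem _ (pm_mem_Esub hu0 n)) he
  obtain ⟨u, hu, m, hm, hk⟩ := mem_Esub_nat hf
  have hc : (u0 ^ n)⁻¹ * e * w ^ (m * T) = u ^ (m * T) * ((u0 ^ n)⁻¹ * e) := by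
    rw [← hk T]; group
  have hlen : d 1 ((u0 ^ n)⁻¹ * e) ≤ 3 * d 1 w + 5 * δ := by
    rwa [hd.comm, hd.inv', mul_one]
  obtain ⟨i, hi1, hiN, hi⟩ := hNT u w hu (Or.inl rfl) ((u0 ^ n)⁻¹ * e) (m * T) (m * T) hlen
    (Nat.le_mul_of_pos_left T hm) (Nat.le_mul_of_pos_left T hm) (by
      rw [hc]
      have := hd.inv (u ^ (m * T)) 1 ((u0 ^ n)⁻¹ * e)
      rw [mul_one] at this
      rw [this]; exact hlen)
  obtain ⟨r, hr⟩ : i ∣ N.factorial := Nat.dvd_factorial hi1 hiN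
  have h2 : (u0 ^ n)⁻¹ * e * w ^ (i * r) * ((u0 ^ n)⁻¹ * e)⁻¹ = u ^ (i * r) := by
    rw [pow_mul, pow_mul, ← hi, conj_pow]
  rw [← hr] at h2
  have hcm : Commute (u0 ^ n) (u ^ N.factorial) := by
    apply Commute.pow_pow
    rcases hu with rfl | rfl <;> rcases hu0 with rfl | rfl
    · exact Commute.refl _
    · exact (Commute.refl _).inv_left
    · exact (Commute.refl _).inv_right
    · exact Commute.refl _
  have h3 : e * w ^ N.factorial * e⁻¹ = u ^ N.factorial := by
    calc e * w ^ N.factorial * e⁻¹ = u0 ^ n * ((u0 ^ n)⁻¹ * e * w ^ N.factorial * ((u0 ^ n)⁻¹ * e)⁻¹) * (u0 ^ n)⁻¹ := by group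
      _ = u ^ N.factorial := by rw [h2, hcm.eq, mul_inv_cancel_right]
  rw [h3]
  rcases hu with rfl | rfl
  · left; rfl
  · right; rw [inv_pow]

end Elem

section Proj

variable {G : Type} [Group G] {d : G → G → ℝ} {δ : ℝ}

theorem E_fin (hd : GMet d δ) {w : G} (hw : Lox d δ w) (R : ℝ) (hR : 0 < R) :
    {h : G | h ∈ Esub w ∧ d 1 h ≤ R}.Finite := by
  obtain ⟨M, hM, hM2⟩ := E_unif hd hw
  have comm_fin : ∀ R : ℝ, 0 < R → {h : G | h * w ^ M * h⁻¹ = w ^ M ∧ d 1 h ≤ R}.Finite := by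
    intro R hR
    obtain ⟨L, hL, N, hN⟩ := hd.acyl R hR
    obtain ⟨k, hk⟩ := exists_nat_ge L
    refine (hN 1 (w ^ (M * k)) ?_).1.subset ?_
    · have h1 := hw.len_ge hd (M * k)
      have h2 : (k : ℝ) ≤ ((M * k : ℕ) : ℝ) := by
        have : k ≤ M * k := Nat.le_mul_of_pos_left k hM
        exact_mod_cast this
      linarith
    · rintro h ⟨h1, h2⟩
      refine ⟨by rwa [mul_one], ?_⟩
      have h3 : h * w ^ (M * k) = w ^ (M * k) * h := by
        have : h * w ^ (M * k) * h⁻¹ = w ^ (M * k) := by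
          rw [pow_mul, ← conj_pow, h1]
        nth_rewrite 2 [← this]
        group
      have h4 := hd.inv (w ^ (M * k)) 1 h
      rw [mul_one] at h4
      rw [h3, h4]
      exact h2
  have inv_fin : {h : G | h * w ^ M * h⁻¹ = (w ^ M)⁻¹ ∧ d 1 h ≤ R}.Finite := by
    rcases Set.eq_empty_or_nonempty {h : G | h * w ^ M * h⁻¹ = (w ^ M)⁻¹ ∧ d 1 h ≤ R} with h0 | ⟨h0, hh0, hh1⟩
    · rw [h0]; exact Set.finite_empty
    · refine Set.Finite.of_finite_image (f := fun h => h0⁻¹ * h) ((comm_fin (2 * R) (by linarith)).subset ?_)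
        (fun a _ b _ hab => mul_left_cancel hab)
      rintro _ ⟨h, ⟨h1, h2⟩, rfl⟩
      refine ⟨?_, ?_⟩
      · have : w ^ M = h0⁻¹ * (w ^ M)⁻¹ * h0 := by rw [← hh0]; group
        calc h0⁻¹ * h * w ^ M * (h0⁻¹ * h)⁻¹ = h0⁻¹ * (h * w ^ M * h⁻¹) * h0 := by group
          _ = w ^ M := by rw [h1, ← this]
      · show d 1 (h0⁻¹ * h) ≤ 2 * R
        rw [hd.comm, hd.inv', mul_one, hd.comm]
        have := hd.tri h0 1 h
        rw [hd.comm h0 1] at this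
        linarith
  refine ((comm_fin R hR).union inv_fin).subset ?_
  rintro h ⟨h1, h2⟩
  rcases hM2 h h1 with h3 | h3
  · exact Or.inl ⟨h3, h2⟩
  · exact Or.inr ⟨h3, h2⟩

theorem E_decomp (hd : GMet d δ) {w : G} (hw : Lox d δ w) :
    ∃ S : Set G, S.Finite ∧ ∀ e ∈ Esub w, ∃ j : ℤ, ∃ s ∈ S, e = w ^ j * s := by
  have hδ := hd.pos
  have hl := hd.nonneg 1 w
  refine ⟨_, E_fin hd hw (3 * d 1 w + 5 * δ) (by linarith), ?_⟩
  intro e he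
  obtain ⟨u, hu, n, hn⟩ := E_near hd hw he
  have hm : (u ^ n)⁻¹ * e ∈ {h : G | h ∈ Esub w ∧ d 1 h ≤ 3 * d 1 w + 5 * δ} := by
    refine ⟨Subgroup.mul_mem _ (Subgroup.inv_mem _ (pm_mem_Esub hu n)) he, ?_⟩
    rwa [hd.comm, hd.inv', mul_one]
  rcases hu with rfl | rfl
  · exact ⟨n, _, hm, by rw [zpow_natCast]; group⟩
  · exact ⟨-n, _, hm, by rw [zpow_neg, zpow_natCast, inv_pow]; group⟩

theorem E_countable (hd : GMet d δ) {w : G} (hw : Lox d δ w) : (Esub w : Set G).Countable := by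
  obtain ⟨S, hS, h⟩ := E_decomp hd hw
  have : (⋃ j : ℤ, (fun s => w ^ j * s) '' S).Countable :=
    Set.countable_iUnion fun j => (hS.image _).countable
  refine this.mono ?_
  intro e he
  obtain ⟨j, s, hs, rfl⟩ := h e he
  exact Set.mem_iUnion.2 ⟨j, s, hs, rfl⟩

theorem E_ne_top (hd : GMet d δ) {w : G} (hw : Lox d δ w) (hv : ¬ IsVirtuallyCyclic G) :
    ∃ f, f ∉ Esub w := by
  by_contra hcon
  push Not at hcon
  apply hv
  refine ⟨Subgroup.zpowers w, inferInstance, ?_⟩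
  obtain ⟨S, hS, h⟩ := E_decomp hd hw
  have : Finite S := hS
  have : Finite (G ⧸ Subgroup.zpowers w) := by
    refine Finite.of_surjective (fun s : S => (QuotientGroup.mk (s : G)⁻¹ : G ⧸ Subgroup.zpowers w)) ?_
    intro x
    obtain ⟨g, rfl⟩ := QuotientGroup.mk_surjective x
    obtain ⟨j, s, hs, hg⟩ := h g⁻¹ (hcon _)
    refine ⟨⟨s, hs⟩, ?_⟩
    rw [QuotientGroup.eq]
    refine ⟨-j, ?_⟩
    have : g = (w ^ j * s)⁻¹ := by rw [← hg, inv_inv]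
    rw [this]
    group
  exact Subgroup.index_ne_zero_of_finite

theorem E_pow (hd : GMet d δ) {w : G} (hw : Lox d δ w) (M : ℕ) (hM : 0 < M) (e : G) (he : e ∈ Esub w) :
    ∃ k : ℕ, 0 < k ∧ ∃ j : ℤ, e ^ k = (w ^ M) ^ j := by
  obtain ⟨S, hS, h⟩ := E_decomp hd hw
  have : Finite S := hS
  have h' : ∀ n : ℕ, ∃ s : S, ∃ j : ℤ, e ^ n = w ^ j * s := by
    intro n
    obtain ⟨j, s, hs, h1⟩ := h _ (Subgroup.pow_mem _ he n)
    exact ⟨⟨s, hs⟩, j, h1⟩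
  choose s j hsj using h'
  have key : ∀ a b : ℕ, a < b → s a = s b → ∃ k : ℕ, 0 < k ∧ ∃ j : ℤ, e ^ k = (w ^ M) ^ j := by
    intro a b hab hs
    refine ⟨(b - a) * M, Nat.mul_pos (by omega) hM, j b - j a, ?_⟩
    have h1 : e ^ (b - a) = w ^ (j b - j a) := by
      rw [pow_sub e hab.le, hsj, hsj, hs, zpow_sub]; group
    rw [pow_mul, h1, ← zpow_natCast, ← zpow_natCast, ← zpow_mul, ← zpow_mul, mul_comm]
  obtain ⟨a, b, hab, hs⟩ := Finite.exists_ne_map_eq_of_infinite s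
  rcases lt_or_gt_of_ne hab with h1 | h1
  · exact key a b h1 hs
  · exact key b a h1 hs.symm

/-- `p` is a near-projection of `a` to `E`. -/
def NP (d : G → G → ℝ) (E : Subgroup G) (a p : G) : Prop := p ∈ E ∧ ∀ e ∈ E, d a p ≤ d a e + 1

theorem NP.trans (hd : GMet d δ) {E : Subgroup G} {a p e : G} (he : e ∈ E) (h : NP d E a p) :
    NP d E (e * a) (e * p) := by
  refine ⟨E.mul_mem he h.1, fun e' he' => ?_⟩
  rw [hd.inv]
  have := h.2 (e⁻¹ * e') (E.mul_mem (E.inv_mem he) he')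
  rwa [hd.comm a (e⁻¹ * e'), hd.inv', hd.comm e'] at this

theorem NP.exists (hd : GMet d δ) (E : Subgroup G) (a : G) : ∃ p, NP d E a p := by
  by_contra hcon
  unfold NP at hcon
  push Not at hcon
  have key : ∀ n : ℕ, ∃ e ∈ E, d a e + n ≤ d a 1 := by
    intro n
    induction n with
    | zero => exact ⟨1, E.one_mem, by simp⟩
    | succ n ih =>
      obtain ⟨e, he, h⟩ := ih
      obtain ⟨e', he', h'⟩ := hcon e he
      refine ⟨e', he', ?_⟩
      push_cast
      linarith
  obtain ⟨n, hn⟩ := exists_nat_gt (d a 1)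
  obtain ⟨e, -, h⟩ := key n
  linarith [hd.nonneg a e]

theorem L7 (hd : GMet d δ) {w : G} (hw : Lox d δ w) : ∃ C : ℝ, 0 ≤ C ∧ ∀ a p q : G,
    NP d (Esub w) a p → q ∈ Esub w → d a p + d p q ≤ d a q + C := by
  have hδ := hd.pos
  have hl := hd.nonneg 1 w
  obtain ⟨j, hj⟩ := exists_nat_gt (d 1 w + δ + δ + 1)
  have hjl : (0:ℝ) ≤ j * d 1 w := by positivity
  refine ⟨1 + δ + 2 * (j * d 1 w) + 2 * (3 * d 1 w + 5 * δ), by linarith, ?_⟩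
  have main : ∀ a q, NP d (Esub w) a 1 → q ∈ Esub w →
      d a 1 + d 1 q ≤ d a q + (1 + δ + 2 * (j * d 1 w) + 2 * (3 * d 1 w + 5 * δ)) := by
    intro a q hp hq
    obtain ⟨u, hu, n, hn⟩ := E_near hd hw hq
    have hul := len_pm1 hd hu
    have lu := lox_pm hd hw hu
    have t1 := hd.tri 1 (u ^ n) q
    have t2 := hd.tri a q (u ^ n)
    have c1 := hd.comm (u ^ n) q
    rcases le_total n j with h | h
    · have l1 := len_le hd u n
      have l2 : (n : ℝ) * d 1 w ≤ j * d 1 w := by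
        apply mul_le_mul_of_nonneg_right _ hl
        exact_mod_cast h
      rw [hul] at l1
      have t3 := hd.tri a (u ^ n) 1
      have c2 := hd.comm (u ^ n) 1
      linarith
    · obtain ⟨r, rfl⟩ := Nat.exists_eq_add_of_le h
      have q4 := hd.four a (u ^ j) 1 (u ^ (j + r))
      have e1 := hd.pow_sub u j r
      have ad := lu.add hd j r
      have g := lu.len_ge hd j
      have l1 := len_le hd u j
      rw [hul] at l1
      have hp2 := hp.2 (u ^ j) (pm_mem_Esub hu j)
      have c2 := hd.comm (u ^ j) 1
      rcases q4 with q4 | q4 <;> linarith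
  intro a p q hp hq
  have := main (p⁻¹ * a) (p⁻¹ * q) (by
    have := hp.trans hd (Subgroup.inv_mem _ hp.1)
    rwa [inv_mul_cancel] at this) (Subgroup.mul_mem _ (Subgroup.inv_mem _ hp.1) hq)
  rw [hd.inv, hd.inv', mul_one, hd.comm 1, hd.inv', mul_one, hd.comm q p] at this
  exact this

theorem L8 (hd : GMet d δ) {w : G} (hw : Lox d δ w) : ∃ C : ℝ, 0 ≤ C ∧ ∀ a b p q : G,
    NP d (Esub w) a p → NP d (Esub w) b q → C < d p q → d a p + d p q + d q b ≤ d a b + C := by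
  have hδ := hd.pos
  obtain ⟨C, hC, h7⟩ := L7 hd hw
  refine ⟨2 * C + δ, by linarith, ?_⟩
  intro a b p q hp hq hpq
  have h1 := h7 a p q hp hq.1
  have h2 := h7 b q p hq hp.1
  have q4 := hd.four a q p b
  have c1 := hd.comm q p
  have c2 := hd.comm b q
  have c3 := hd.comm b p
  rcases q4 with q4 | q4 <;> linarith

theorem L9 (hd : GMet d δ) {w : G} (hw : Lox d δ w) : ∃ C : ℝ, 0 ≤ C ∧ ∀ f e p q : G,
    f ∉ Esub w → e ∈ Esub w → NP d (Esub w) f p → NP d (Esub w) (f * e) q → d p q ≤ C := by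
  have hδ := hd.pos
  have hl := hd.nonneg 1 w
  obtain ⟨C, hC, h8⟩ := L8 hd hw
  set C2 := 3 * d 1 w + 5 * δ with hC2
  set D := C + 2 * C2 + 2 * d 1 w + 2 * δ with hD
  obtain ⟨N, T, hNT⟩ := overlap hd hw (D + C2) (by linarith)
  have hTl : (0:ℝ) ≤ T * d 1 w := by positivity
  refine ⟨C + T * d 1 w + 2 * D + C2, by linarith, ?_⟩
  intro f e p q hf he hp hq
  by_contra hcon
  push Not at hcon
  have con := h8 f (f * e) p q hp hq (by linarith)
  obtain ⟨v, hv, k, hk⟩ := E_near hd hw he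
  have hvl := len_pm1 hd hv
  have lv := lox_pm hd hw hv
  have efe : d f (f * e) = d 1 e := by have := hd.inv f 1 e; rwa [mul_one] at this
  have t0 := hd.tri 1 (v ^ k) e
  have c0 := hd.comm e (v ^ k)
  have near : ∀ z, d f z + d z (f * e) ≤ d f (f * e) + C → ∃ i, d z (f * v ^ i) ≤ D := by
    intro z hz
    have e1 : d 1 (f⁻¹ * z) = d f z := by rw [hd.comm, hd.inv', mul_one, hd.comm]
    have e2 : d (f⁻¹ * z) e = d z (f * e) := hd.inv' _ _ _
    have t1 := hd.tri (f⁻¹ * z) e (v ^ k)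
    obtain ⟨i, -, hi⟩ := lv.near hd (f⁻¹ * z) k (C + 2 * C2) (by linarith)
    refine ⟨i, ?_⟩
    rw [hd.inv'] at hi
    linarith
  have np := hd.nonneg f p
  have nq := hd.nonneg q (f * e)
  obtain ⟨i, hi⟩ := near p (by linarith [hd.tri p q (f * e)])
  obtain ⟨i', hi'⟩ := near q (by linarith [hd.tri f p q])
  obtain ⟨u, hu, n, hn⟩ := E_near hd hw
    (Subgroup.mul_mem _ (Subgroup.inv_mem _ hp.1) hq.1 : p⁻¹ * q ∈ Esub w)
  have hul := len_pm1 hd hu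
  obtain ⟨v', hv', n', hvv⟩ : ∃ v', (v' = w ∨ v' = w⁻¹) ∧ ∃ n', v ^ i * v' ^ n' = v ^ i' := by
    rcases le_total i i' with h | h
    · obtain ⟨r, rfl⟩ := Nat.exists_eq_add_of_le h
      exact ⟨v, hv, r, (pow_add _ _ _).symm⟩
    · obtain ⟨r, rfl⟩ := Nat.exists_eq_add_of_le h
      exact ⟨v⁻¹, by rcases hv with rfl | rfl <;> simp, r, by rw [pow_add, inv_pow, mul_inv_cancel_right]⟩
  have hvl' := len_pm1 hd hv'
  have lt_of : ∀ m : ℕ, T * d 1 w < m * d 1 w → T ≤ m := by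
    intro m hm
    by_contra hc
    push Not at hc
    have : (m : ℝ) ≤ T := by exact_mod_cast hc.le
    nlinarith
  have hpq : d 1 (p⁻¹ * q) = d p q := by rw [hd.comm, hd.inv', mul_one, hd.comm]
  have hnT : T ≤ n := by
    apply lt_of
    have l := len_le hd u n
    rw [hul] at l
    have := hd.tri 1 (u ^ n) (p⁻¹ * q)
    have := hd.comm (u ^ n) (p⁻¹ * q)
    linarith
  have hnT' : T ≤ n' := by
    apply lt_of
    have l := len_le hd v' n'
    rw [hvl'] at l
    have t1 := hd.tri p (f * v ^ i) q
    have t2 := hd.tri (f * v ^ i) (f * v ^ i') q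
    have e1 : d (f * v ^ i) (f * v ^ i') = d 1 (v' ^ n') := by
      rw [hd.inv, ← hvv]
      have := hd.inv (v ^ i) 1 (v' ^ n'); rwa [mul_one] at this
    have c1 := hd.comm q (f * v ^ i')
    linarith
  obtain ⟨e', he1, -, he'⟩ := hNT u v' hu hv' (p⁻¹ * (f * v ^ i)) n n' (by
    rw [hd.comm, hd.inv', mul_one, hd.comm]; linarith) hnT hnT' (by
    have e1 : p⁻¹ * (f * v ^ i) * v' ^ n' = p⁻¹ * (f * v ^ i') := by rw [← hvv]; group
    rw [e1]
    have := hd.tri (u ^ n) (p⁻¹ * q) (p⁻¹ * (f * v ^ i'))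
    rw [hd.inv, hd.comm (u ^ n) (p⁻¹ * q)] at this
    linarith)
  have hmem := mem_Esub_of hu hv' e' he1 he'
  apply hf
  have : f = p * (p⁻¹ * (f * v ^ i)) * (v ^ i)⁻¹ := by group
  rw [this]
  exact Subgroup.mul_mem _ (Subgroup.mul_mem _ hp.1 hmem) (Subgroup.inv_mem _ (pm_mem_Esub hv i))

end Proj

/-- The axioms of the system of projections to the cosets of `E` used in the construction. -/
structure Axes {G : Type} [Group G] (E : Subgroup G) (v : G) (dd : G → G → G → ℝ) (len : G → ℝ)
    (C θ : ℝ) : Prop where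
  hC : 0 ≤ C
  hθ : 0 ≤ θ
  len_nonneg : ∀ g, 0 ≤ len g
  nonneg : ∀ q a b, 0 ≤ dd q a b
  self : ∀ q a, dd q a a = 0
  symm : ∀ q a b, dd q a b = dd q b a
  tri : ∀ q a b c, dd q a c ≤ dd q a b + dd q b c
  equi : ∀ g q a b, dd (g * q) (g * a) (g * b) = dd q a b
  coset : ∀ q e a b, e ∈ E → dd (q * e) a b = dd q a b
  lip : ∀ q a b, dd q a (a * b) ≤ len b + C
  small : ∀ q r e, q⁻¹ * r ∉ E → e ∈ E → dd q r (r * e) ≤ θ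
  behr : ∀ q r a, q⁻¹ * r ∉ E → dd q a r ≤ θ ∨ dd r a q ≤ θ
  growth : ∀ n : ℕ, (n : ℝ) ≤ dd 1 1 (v ^ n) + C
  vmem : v ∈ E
  conj : ∀ e ∈ E, e * v * e⁻¹ = v ∨ e * v * e⁻¹ = v⁻¹
  proper : ∃ f, f ∉ E
  countable : (E : Set G).Countable
  power : ∀ e ∈ E, ∃ k : ℕ, 0 < k ∧ ∃ j : ℤ, e ^ k = v ^ j

section Build

variable {G : Type} [Group G] {d : G → G → ℝ} {δ : ℝ}

theorem exists_equi_proj (hd : GMet d δ) (E : Subgroup G) :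
    ∃ π : G → G, (∀ a, NP d E a (π a)) ∧ ∀ e ∈ E, ∀ a, π (e * a) = e * π a := by
  choose π0 h0 using NP.exists hd E
  let rep : G → G := fun a => Quotient.out (Quotient.mk (QuotientGroup.rightRel E) a)
  have hrep : ∀ a, a * (rep a)⁻¹ ∈ E := by
    intro a
    have : (QuotientGroup.rightRel E) (rep a) a := Quotient.mk_out (s := QuotientGroup.rightRel E) a
    rwa [QuotientGroup.rightRel_apply] at this
  have hrep2 : ∀ e ∈ E, ∀ a, rep (e * a) = rep a := by
    intro e he a
    have : (Quotient.mk (QuotientGroup.rightRel E) (e * a)) = Quotient.mk (QuotientGroup.rightRel E) a := by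
      apply Quotient.sound
      show (QuotientGroup.rightRel E) _ _
      rw [QuotientGroup.rightRel_apply]
      have : a * (e * a)⁻¹ = e⁻¹ := by group
      rw [this]; exact E.inv_mem he
    show Quotient.out _ = Quotient.out _
    rw [this]
  refine ⟨fun a => a * (rep a)⁻¹ * π0 (rep a), ?_, ?_⟩
  · intro a
    have := (h0 (rep a)).trans hd (hrep a)
    rwa [inv_mul_cancel_right] at this
  · intro e he a
    show e * a * (rep (e * a))⁻¹ * π0 (rep (e * a)) = _
    rw [hrep2 e he]
    group

theorem exists_axes (hd : GMet d δ) {w : G} (hw : Lox d δ w) (hv : ¬ IsVirtuallyCyclic G) :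
    ∃ (E : Subgroup G) (v : G) (dd : G → G → G → ℝ) (len : G → ℝ) (C θ : ℝ), Axes E v dd len C θ := by
  have hδ := hd.pos
  obtain ⟨M, hM, hM2⟩ := E_unif hd hw
  obtain ⟨C7, hC7, h7⟩ := L7 hd hw
  obtain ⟨C8, hC8, h8⟩ := L8 hd hw
  obtain ⟨C9, hC9, h9⟩ := L9 hd hw
  obtain ⟨π, hπ, hπe⟩ := exists_equi_proj hd (Esub w)
  have hvm : w ^ M ∈ Esub w := Subgroup.pow_mem _ (self_mem_Esub w) M
  refine ⟨Esub w, w ^ M, fun q a b => d (π (q⁻¹ * a)) (π (q⁻¹ * b)), fun g => d 1 g, C8 + 2,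
    C7 + C8 + 1 + C9, ?_⟩
  refine ⟨by linarith, by linarith, fun g => hd.nonneg _ _, fun q a b => hd.nonneg _ _,
    fun q a => hd.self _, fun q a b => hd.comm _ _, fun q a b c => hd.tri _ _ _, ?_, ?_, ?_, ?_, ?_,
    ?_, hvm, hM2, E_ne_top hd hw hv, E_countable hd hw, E_pow hd hw M hM⟩
  · intro g q a b
    show d (π ((g * q)⁻¹ * (g * a))) (π ((g * q)⁻¹ * (g * b))) = _
    congr 2 <;> group
  · intro q e a b he
    show d (π ((q * e)⁻¹ * a)) (π ((q * e)⁻¹ * b)) = _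
    rw [mul_inv_rev, mul_assoc, mul_assoc, hπe _ (Subgroup.inv_mem _ he), hπe _ (Subgroup.inv_mem _ he),
      hd.inv]
  · intro q a b
    show d (π (q⁻¹ * a)) (π (q⁻¹ * (a * b))) ≤ d 1 b + (C8 + 2)
    have e1 : d (q⁻¹ * a) (q⁻¹ * (a * b)) = d 1 b := by
      rw [hd.inv]
      have := hd.inv a 1 b; rwa [mul_one] at this
    have n1 := hd.nonneg 1 b
    by_cases hc : C8 < d (π (q⁻¹ * a)) (π (q⁻¹ * (a * b)))
    · have := h8 _ _ _ _ (hπ (q⁻¹ * a)) (hπ (q⁻¹ * (a * b))) hc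
      have := hd.nonneg (q⁻¹ * a) (π (q⁻¹ * a))
      have := hd.nonneg (π (q⁻¹ * (a * b))) (q⁻¹ * (a * b))
      linarith
    · linarith
  · intro q r e hqr he
    show d (π (q⁻¹ * r)) (π (q⁻¹ * (r * e))) ≤ _
    rw [← mul_assoc q⁻¹ r e]
    have := h9 _ e _ _ hqr he (hπ (q⁻¹ * r)) (hπ (q⁻¹ * r * e))
    linarith
  · intro q r a hqr
    show d (π (q⁻¹ * a)) (π (q⁻¹ * r)) ≤ _ ∨ d (π (r⁻¹ * a)) (π (r⁻¹ * q)) ≤ _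
    by_contra hcon
    push Not at hcon
    obtain ⟨h1, h2⟩ := hcon
    set f := q⁻¹ * r with hf
    set a' := q⁻¹ * a with ha'
    have e1 : r⁻¹ * a = f⁻¹ * a' := by rw [hf, ha']; group
    have e2 : r⁻¹ * q = f⁻¹ := by rw [hf]; group
    rw [e1, e2] at h2
    set z := π (f⁻¹ * a') with hz
    have hzE : z ∈ Esub w := (hπ _).1
    have k1 := h9 f z _ _ hqr hzE (hπ f) (hπ (f * z))
    have t1 := hd.tri (π a') (π (f * z)) (π f)
    have c1 := hd.comm (π f) (π (f * z))
    have con := h8 a' (f * z) _ _ (hπ a') (hπ (f * z)) (by linarith)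
    have t2 := hd.tri (π a') (π (f * z)) (f * z)
    have hpE : π a' ∈ Esub w := (hπ _).1
    have k2 := h9 f⁻¹ (π a') _ _ (fun h => hqr (by
      have := Subgroup.inv_mem _ h; rwa [inv_inv] at this)) hpE (hπ f⁻¹) (hπ (f⁻¹ * π a'))
    have k3 := h7 (f⁻¹ * a') z (π (f⁻¹ * π a')) (hπ _) (hπ _).1
    have k4 := (hπ (f⁻¹ * π a')).2 z hzE
    have t3 := hd.tri a' (π a') (f * π (f⁻¹ * π a'))
    rw [hd.inv' f a', hd.inv' f a'] at k3
    rw [hd.inv', hd.inv'] at k4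
    have t4 := hd.tri z (π (f⁻¹ * π a')) (π f⁻¹)
    have c2 := hd.comm (π f⁻¹) (π (f⁻¹ * π a'))
    linarith
  · intro n
    show (n : ℝ) ≤ d (π (1⁻¹ * 1)) (π (1⁻¹ * (w ^ M) ^ n)) + _
    rw [inv_one, one_mul, one_mul, ← pow_mul]
    have h1 := (hπ 1).2 1 (Subgroup.one_mem _)
    have h2 := (hπ (w ^ (M * n))).2 (w ^ (M * n)) (Subgroup.pow_mem _ (self_mem_Esub w) _)
    rw [hd.self] at h1 h2
    have h3 := hw.len_ge hd (M * n)
    have h4 : (n : ℝ) ≤ ((M * n : ℕ) : ℝ) := by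
      have : n ≤ M * n := Nat.le_mul_of_pos_left n hM
      exact_mod_cast this
    have t1 := hd.tri 1 (π 1) (w ^ (M * n))
    have t2 := hd.tri (π 1) (π (w ^ (M * n))) (w ^ (M * n))
    have c := hd.comm (w ^ (M * n)) (π (w ^ (M * n)))
    linarith

end Build

section Endgame

variable {G : Type} [Group G] {E : Subgroup G} {v : G} {dd : G → G → G → ℝ} {len : G → ℝ} {C θ : ℝ}

theorem Axes.left (ax : Axes E v dd len C θ) {e : G} (he : e ∈ E) (a b : G) :
    dd 1 (e * a) (e * b) = dd 1 a b := by
  have h1 := ax.equi e e⁻¹ a b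
  have h2 := ax.coset 1 e⁻¹ a b (E.inv_mem he)
  rw [mul_inv_cancel] at h1
  rw [one_mul] at h2
  rw [h1, h2]

theorem Axes.growthZ (ax : Axes E v dd len C θ) (k : ℤ) : |(k : ℝ)| ≤ dd 1 1 (v ^ k) + C := by
  have hn : ∀ n : ℕ, dd 1 1 (v ^ (-(n : ℤ))) = dd 1 1 (v ^ n) := by
    intro n
    have := ax.left (E.pow_mem ax.vmem n) 1 (v ^ (-(n : ℤ)))
    rw [zpow_neg, zpow_natCast, mul_inv_cancel, mul_one] at this
    rw [zpow_neg, zpow_natCast, ← this, ax.symm]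
  obtain ⟨n, rfl | rfl⟩ := Int.eq_nat_or_neg k
  · have := ax.growth n
    simpa using this
  · rw [hn]
    have := ax.growth n
    simpa using this

theorem Axes.growth2 (ax : Axes E v dd len C θ) (m n : ℤ) :
    |((n - m : ℤ) : ℝ)| ≤ dd 1 (v ^ m) (v ^ n) + C := by
  have := ax.left (E.zpow_mem ax.vmem m) 1 (v ^ (n - m))
  rw [mul_one, ← zpow_add, show m + (n - m) = n by ring] at this
  rw [this]
  exact ax.growthZ _

theorem Axes.mal (ax : Axes E v dd len C θ) {q : G} (hq : q ∉ E) {n : ℤ} (hn : n ≠ 0) :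
    q⁻¹ * v ^ n * q ∉ E := by
  intro h
  obtain ⟨k, hk⟩ := exists_nat_gt (dd 1 1 q + θ + dd 1 1 q + C)
  have e1 : q * (q⁻¹ * v ^ n * q) ^ k = v ^ (n * k) * q := by
    have : (q⁻¹ * v ^ n * q) ^ k = q⁻¹ * (v ^ n) ^ k * q := by
      have := conj_pow (i := k) (a := q⁻¹) (b := v ^ n)
      rwa [inv_inv] at this
    rw [this, zpow_mul, zpow_natCast]; group
  have h1 := ax.small 1 q _ (by rwa [inv_one, one_mul]) (E.pow_mem h k)
  rw [e1] at h1
  have t1 := ax.tri 1 1 q (v ^ (n * k))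
  have t2 := ax.tri 1 q (v ^ (n * k) * q) (v ^ (n * k))
  have h2 := ax.left (E.zpow_mem ax.vmem (n * k)) q 1
  rw [mul_one, ax.symm 1 q 1] at h2
  have h3 := ax.growthZ (n * k)
  have h4 : (k : ℝ) ≤ |((n * k : ℤ) : ℝ)| := by
    have : (k : ℤ) ≤ |n * k| := by
      rw [abs_mul, Nat.abs_cast]
      have := Int.one_le_abs hn
      nlinarith [Int.natCast_nonneg k]
    exact_mod_cast this
  linarith

theorem Axes.lemM (ax : Axes E v dd len C θ) {g q : G} (h : q⁻¹ * (g * q) ∉ E) :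
    ∃ M : ℝ, ∀ k : ℤ, dd q 1 (g ^ k) ≤ M := by
  refine ⟨θ + (len g⁻¹ + C) + (len g + C) + dd q 1 (g * q) + dd (g * q) 1 q, fun k => ?_⟩
  have n1 := ax.len_nonneg g
  have n2 := ax.len_nonneg g⁻¹
  have n3 := ax.nonneg q 1 (g * q)
  have n4 := ax.nonneg (g * q) 1 q
  have n5 := ax.hC
  rcases ax.behr q (g * q) (g ^ k) h with h1 | h1
  · have t := ax.tri q 1 (g * q) (g ^ k)
    rw [ax.symm q (g * q)] at t
    linarith
  · have t := ax.tri (g * q) 1 q (g ^ k)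
    rw [ax.symm (g * q) q] at t
    have e := ax.equi g q g⁻¹ (g ^ (k - 1))
    have e2 : g * g ^ (k - 1) = g ^ k := by
      rw [← zpow_one_add]; congr 1; ring
    have e3 : g ^ (k - 1) * g = g ^ k := by
      rw [← zpow_add_one]; congr 1; ring
    rw [mul_inv_cancel, e2] at e
    have l1 := ax.lip q 1 g⁻¹
    have l2 := ax.lip q (g ^ (k - 1)) g
    rw [one_mul] at l1
    rw [e3] at l2
    have t1 := ax.tri q 1 g⁻¹ (g ^ k)
    have t2 := ax.tri q g⁻¹ (g ^ (k - 1)) (g ^ k)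
    linarith

/-- conjugated form of `left` -/
theorem Axes.shift (ax : Axes E v dd len C θ) (r q : G) (n : ℕ) :
    (n : ℝ) ≤ dd r q ((r * v * r⁻¹) ^ n * q) + C + 2 * dd 1 1 (r⁻¹ * q) := by
  have e1 := ax.equi r⁻¹ r q ((r * v * r⁻¹) ^ n * q)
  rw [inv_mul_cancel, conj_pow] at e1
  have e2 : r⁻¹ * (r * v ^ n * r⁻¹ * q) = v ^ n * (r⁻¹ * q) := by group
  rw [e2] at e1
  rw [conj_pow, ← e1]
  have t1 := ax.tri 1 1 (r⁻¹ * q) (v ^ n)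
  have t2 := ax.tri 1 (r⁻¹ * q) (v ^ n * (r⁻¹ * q)) (v ^ n)
  have h2 := ax.left (E.pow_mem ax.vmem n) (r⁻¹ * q) 1
  rw [mul_one, ax.symm 1 (r⁻¹ * q) 1] at h2
  have := ax.growth n
  linarith

theorem Axes.lemN (ax : Axes E v dd len C θ) {F : Set G} (hF : F.Finite)
    (hK : ∀ f ∈ F, f ∉ E.normalCore) : ∃ q, ∀ f ∈ F, q⁻¹ * f * q ∉ E := by
  induction F, hF using Set.Finite.induction_on with
  | empty => exact ⟨1, by simp⟩
  | @insert g F' hg hF' ih =>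
    obtain ⟨q, hq⟩ := ih (fun f hf => hK f (Set.mem_insert_of_mem _ hf))
    by_cases hgq : q⁻¹ * g * q ∉ E
    · refine ⟨q, ?_⟩
      rintro f (rfl | hf)
      · exact hgq
      · exact hq f hf
    push Not at hgq
    obtain ⟨r, hr⟩ : ∃ r, r⁻¹ * g * r ∉ E := by
      by_contra hcon
      push Not at hcon
      apply hK g (Set.mem_insert _ _)
      intro b
      have := hcon b⁻¹
      rwa [inv_inv] at this
    have hrq : r⁻¹ * q ∉ E := by
      intro h
      apply hr
      have : r⁻¹ * g * r = (r⁻¹ * q) * (q⁻¹ * g * q) * (r⁻¹ * q)⁻¹ := by group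
      rw [this]
      exact E.mul_mem (E.mul_mem h hgq) (E.inv_mem h)
    set u := r * v * r⁻¹ with hu
    have key : ∀ f ∈ insert g F', ∀ᶠ n : ℕ in Filter.atTop, (u ^ n * q)⁻¹ * f * (u ^ n * q) ∉ E := by
      intro f hf
      by_cases hfr : r⁻¹ * f * r ∈ E
      · have hfF : f ∈ F' := by
          rcases hf with rfl | hf
          · exact absurd hfr hr
          · exact hf
        have hfq := hq f hfF
        rcases ax.conj _ hfr with hc | hc
        · have hc2 : f * u * f⁻¹ = u := by
            calc f * u * f⁻¹ = r * (r⁻¹ * f * r * v * (r⁻¹ * f * r)⁻¹) * r⁻¹ := by rw [hu]; group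
              _ = u := by rw [hc]
          refine Filter.Eventually.of_forall fun n => ?_
          have h3 : f * u ^ n = u ^ n * f := by
            have : f * u ^ n * f⁻¹ = u ^ n := by rw [← conj_pow, hc2]
            nth_rewrite 2 [← this]; group
          have : (u ^ n * q)⁻¹ * f * (u ^ n * q) = q⁻¹ * f * q := by
            calc (u ^ n * q)⁻¹ * f * (u ^ n * q) = q⁻¹ * (u ^ n)⁻¹ * (f * u ^ n) * q := by group
              _ = q⁻¹ * f * q := by rw [h3]; group
          rwa [this]
        · have hc2 : f * u * f⁻¹ = u⁻¹ := by
            calc f * u * f⁻¹ = r * (r⁻¹ * f * r * v * (r⁻¹ * f * r)⁻¹) * r⁻¹ := by rw [hu]; group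
              _ = u⁻¹ := by rw [hc, hu]; group
          have h4 : ∀ n : ℕ, (u ^ n * q)⁻¹ * f * (u ^ n * q) = q⁻¹ * u ^ (-(2 * n : ℤ)) * f * q := by
            intro n
            have h3 : f * u ^ n = (u ^ n)⁻¹ * f := by
              have : f * u ^ n * f⁻¹ = (u ^ n)⁻¹ := by rw [← conj_pow, hc2, inv_pow]
              rw [← this]; group
            calc (u ^ n * q)⁻¹ * f * (u ^ n * q) = q⁻¹ * (u ^ n)⁻¹ * (f * u ^ n) * q := by group
              _ = q⁻¹ * ((u ^ n)⁻¹ * (u ^ n)⁻¹) * f * q := by rw [h3]; group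
              _ = _ := by
                congr 3
                rw [← zpow_natCast, ← zpow_neg, ← zpow_add]; congr 1; ring
          by_cases hbad : ∃ n0 : ℕ, (u ^ n0 * q)⁻¹ * f * (u ^ n0 * q) ∈ E
          · obtain ⟨n0, h0⟩ := hbad
            filter_upwards [Filter.eventually_gt_atTop n0] with n hn h1
            rw [h4] at h0 h1
            have h5 := E.mul_mem h0 (E.inv_mem h1)
            refine ax.mal hrq (n := 2 * n - 2 * n0) (by omega) ?_
            have e1 : v = r⁻¹ * u * r := by rw [hu]; group
            have e2 : v ^ (2 * n - 2 * n0 : ℤ) = r⁻¹ * u ^ (2 * n - 2 * n0 : ℤ) * r := by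
              have := conj_zpow (i := (2 * n - 2 * n0 : ℤ)) (a := r⁻¹) (b := u)
              rw [inv_inv] at this
              rw [e1, this]
            have e3 : (r⁻¹ * q)⁻¹ * v ^ (2 * n - 2 * n0 : ℤ) * (r⁻¹ * q)
                = q⁻¹ * u ^ (2 * n - 2 * n0 : ℤ) * q := by rw [e2]; group
            rw [e3, show (2 * n - 2 * n0 : ℤ) = -(2 * n0) + 2 * n by ring, zpow_add]
            have e4 : q⁻¹ * u ^ (-(2 * n0 : ℤ)) * f * q * (q⁻¹ * u ^ (-(2 * n : ℤ)) * f * q)⁻¹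
                = q⁻¹ * u ^ (-(2 * n0 : ℤ)) * (u ^ (-(2 * n : ℤ)))⁻¹ * q := by group
            rw [e4, ← zpow_neg, neg_neg, mul_assoc q⁻¹] at h5
            exact h5
          · push Not at hbad
            exact Filter.Eventually.of_forall hbad
      · obtain ⟨n1, hn1⟩ := exists_nat_gt (2 * θ + dd r q (f * r) + dd r q (f⁻¹ * r) + C + 2 * dd 1 1 (r⁻¹ * q))
        filter_upwards [Filter.eventually_ge_atTop n1] with n hn hmem
        have hn' : (n1 : ℝ) ≤ n := by exact_mod_cast hn
        have sh := ax.shift r q n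
        rw [← hu] at sh
        set y := u ^ n * q with hy
        have p1 := ax.nonneg r q (f * r)
        have p2 := ax.nonneg r q (f⁻¹ * r)
        have hθ := ax.hθ
        have big1 : θ < dd r y (f * r) := by
          have t := ax.tri r q (f * r) y
          rw [ax.symm r (f * r) y] at t
          linarith
        have hne : r⁻¹ * (f * r) ∉ E := by rwa [← mul_assoc]
        have sm : dd (f * r) y r ≤ θ := by
          rcases ax.behr r (f * r) y hne with h | h
          · linarith
          · exact h
        have hne2 : (f * r)⁻¹ * y ∉ E := by
          intro h
          have := ax.small r (f * r) _ hne h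
          rw [mul_inv_cancel_left, ax.symm] at this
          linarith
        have s2 := ax.small (f * r) y _ hne2 hmem
        have e1 : y * (y⁻¹ * f * y) = f * y := by group
        rw [e1] at s2
        have e2 := ax.equi f r y (f⁻¹ * r)
        rw [mul_inv_cancel_left] at e2
        have t1 := ax.tri (f * r) (f * y) y r
        rw [ax.symm (f * r) (f * y) y] at t1
        have t2 := ax.tri r q (f⁻¹ * r) y
        rw [ax.symm r (f⁻¹ * r) y] at t2
        linarith
    have hall := (Set.Finite.insert g hF').eventually_all (l := Filter.atTop)
      (p := fun (f : G) (n : ℕ) => (u ^ n * q)⁻¹ * f * (u ^ n * q) ∉ E) |>.2 key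
    obtain ⟨n, hn⟩ := hall.exists
    exact ⟨u ^ n * q, hn⟩

end Endgame

section PingPong

variable {G : Type} [Group G]

/-- Reduced words in the ping-pong game. -/
inductive Red {I : Type} (K : Subgroup G) (s : I → G) : Option I → G → Prop
  | base (κ : G) (h : κ ∈ K) : Red K s none κ
  | step (o : Option I) (h : G) (i : I) (k : ℤ) (hr : Red K s o h) (ho : o ≠ some i)
      (hk : s i ^ k ∉ K) : Red K s (some i) (s i ^ k * h)

theorem Red.mulK {I : Type} {K : Subgroup G} (hK : K.Normal) {s : I → G} {o : Option I} {h : G}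
    (hr : Red K s o h) : ∀ κ ∈ K, Red K s o (κ * h) := by
  induction hr with
  | base κ' h => intro κ hκ; exact Red.base _ (K.mul_mem hκ h)
  | step o h i k hr ho hk ih =>
    intro κ hκ
    have h1 : (s i ^ k)⁻¹ * κ * s i ^ k ∈ K := by
      have := hK.conj_mem κ hκ (s i ^ k)⁻¹
      rwa [inv_inv] at this
    have := Red.step o _ i k (ih _ h1) ho hk
    have e : s i ^ k * ((s i ^ k)⁻¹ * κ * s i ^ k * h) = κ * (s i ^ k * h) := by group
    rwa [e] at this

theorem Red.mulS {I : Type} {K : Subgroup G} (hK : K.Normal) {s : I → G} {o : Option I} {h : G}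
    (hr : Red K s o h) (i : I) (j : ℤ) : ∃ o', Red K s o' (s i ^ j * h) := by
  by_cases hj : s i ^ j ∈ K
  · exact ⟨o, hr.mulK hK _ hj⟩
  by_cases ho : o = some i
  · cases hr with
    | base κ h => cases ho
    | step o h i' k hr ho' hk =>
      cases ho
      rw [← mul_assoc, ← zpow_add]
      by_cases hjk : s i ^ (j + k) ∈ K
      · exact ⟨_, hr.mulK hK _ hjk⟩
      · exact ⟨_, Red.step _ _ _ _ hr ho' hjk⟩
  · exact ⟨_, Red.step _ _ _ _ hr ho hj⟩

theorem Red.mem {I : Type} {K : Subgroup G} {s : I → G} {U : I → Set G}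
    (hU : ∀ i j a, a ∈ U i → a ∈ U j → i = j) (hKU : ∀ i, ∀ κ ∈ K, κ ∉ U i)
    (hs : ∀ i (k : ℤ), s i ^ k ∉ K → ∀ a, a ∉ U i → s i ^ k * a ∈ U i)
    {o : Option I} {h : G} (hr : Red K s o h) : (o = none → h ∈ K) ∧ ∀ i, o = some i → h ∈ U i := by
  induction hr with
  | base κ h => exact ⟨fun _ => h, fun i hi => absurd hi (by simp)⟩
  | step o h i k hr ho hk ih =>
    refine ⟨fun h => absurd h (by simp), ?_⟩
    rintro j hj
    cases hj
    apply hs i k hk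
    intro hmem
    rcases o with _ | j
    · exact hKU i h (ih.1 rfl) hmem
    · exact ho (by rw [hU i j h hmem (ih.2 j rfl)])

theorem pingpong {I : Type} {K : Subgroup G} (hK : K.Normal) {s : I → G} {U : I → Set G}
    (hU : ∀ i j a, a ∈ U i → a ∈ U j → i = j) (hKU : ∀ i, ∀ κ ∈ K, κ ∉ U i)
    (hs : ∀ i (k : ℤ), s i ^ k ∉ K → ∀ a, a ∉ U i → s i ^ k * a ∈ U i) (w : G) (hw : w ∉ K)
    (hwU : ∀ i, w ∉ U i) : w ∉ Subgroup.closure ((K : Set G) ∪ Set.range s) := by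
  intro hmem
  have key : ∀ x ∈ Subgroup.closure ((K : Set G) ∪ Set.range s),
      (∀ h, (∃ o, Red K s o h) → ∃ o, Red K s o (x * h)) ∧
      (∀ h, (∃ o, Red K s o h) → ∃ o, Red K s o (x⁻¹ * h)) := by
    intro x hx
    induction hx using Subgroup.closure_induction with
    | mem x hx =>
      rcases hx with hx | ⟨i, rfl⟩
      · exact ⟨fun h ⟨o, ho⟩ => ⟨o, ho.mulK hK _ hx⟩, fun h ⟨o, ho⟩ => ⟨o, ho.mulK hK _ (K.inv_mem hx)⟩⟩
      · refine ⟨fun h ⟨o, ho⟩ => ?_, fun h ⟨o, ho⟩ => ?_⟩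
        · have := ho.mulS hK i 1
          rwa [zpow_one] at this
        · have := ho.mulS hK i (-1)
          rwa [zpow_neg_one] at this
    | one => simp
    | mul x y _ _ hx hy =>
      refine ⟨fun h ho => ?_, fun h ho => ?_⟩
      · rw [mul_assoc]; exact hx.1 _ (hy.1 _ ho)
      · rw [mul_inv_rev, mul_assoc]; exact hy.2 _ (hx.2 _ ho)
    | inv x _ hx => exact ⟨hx.2, by rw [inv_inv]; exact hx.1⟩
  obtain ⟨o, ho⟩ := (key w hmem).1 1 ⟨none, Red.base 1 K.one_mem⟩
  rw [mul_one] at ho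
  have := ho.mem hU hKU hs
  rcases o with _ | i
  · exact hw (this.1 rfl)
  · exact hwU i (this.2 i rfl)

end PingPong

section Final

variable {G : Type} [Group G] {E : Subgroup G} {v : G} {dd : G → G → G → ℝ} {len : G → ℝ} {C θ : ℝ}

theorem mem_core_conj {k : G} (hk : k ∈ E.normalCore) (q : G) : q⁻¹ * k * q ∈ E := by
  have := hk q⁻¹
  rwa [inv_inv] at this

theorem Axes.lemA (ax : Axes E v dd len C θ) {g : G} (hg : g ∉ E.normalCore) :
    ∃ q, ∀ k : ℤ, q⁻¹ * g ^ k * q ∈ E → g ^ k ∈ E.normalCore := by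
  by_cases hd : ∃ n : ℤ, n ≠ 0 ∧ g ^ n ∈ E.normalCore
  · obtain ⟨n, hn, hnK⟩ := hd
    obtain ⟨q, hq⟩ := ax.lemN (F := (fun k : ℤ => g ^ k) '' Set.Icc 0 |n| ∩ {x | x ∉ E.normalCore})
      (((Set.finite_Icc _ _).image _).subset Set.inter_subset_left) (fun f hf => hf.2)
    refine ⟨q, fun k hk => ?_⟩
    have e : g ^ k = (g ^ n) ^ (k / n) * g ^ (k % n) := by
      rw [← zpow_mul, ← zpow_add, Int.mul_ediv_add_emod]
    have h1 : (g ^ n) ^ (k / n) ∈ E.normalCore := Subgroup.zpow_mem _ hnK _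
    have h2 : g ^ (k % n) ∈ E.normalCore := by
      by_contra hcon
      refine hq _ ⟨⟨k % n, ⟨Int.emod_nonneg _ hn, (Int.emod_lt_abs _ hn).le⟩, rfl⟩, hcon⟩ ?_
      have : q⁻¹ * g ^ (k % n) * q = (q⁻¹ * (g ^ n) ^ (k / n) * q)⁻¹ * (q⁻¹ * g ^ k * q) := by
        rw [e]; group
      rw [this]
      exact E.mul_mem (E.inv_mem (mem_core_conj h1 q)) hk
    rw [e]
    exact Subgroup.mul_mem _ h1 h2
  · push Not at hd
    by_contra hcon
    push Not at hcon
    obtain ⟨f, hf⟩ := ax.proper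
    obtain ⟨a, ha, haK⟩ := hcon 1
    obtain ⟨b, hb, hbK⟩ := hcon f
    have ha0 : a ≠ 0 := by rintro rfl; apply haK; rw [zpow_zero]; exact Subgroup.one_mem _
    have hb0 : b ≠ 0 := by rintro rfl; apply hbK; rw [zpow_zero]; exact Subgroup.one_mem _
    rw [inv_one, one_mul, mul_one] at ha
    obtain ⟨k, hk, j, hj⟩ := ax.power _ ha
    have h1 : (g ^ b) ^ (a * k) = v ^ (j * b) := by
      rw [zpow_mul v, ← hj, ← zpow_natCast, ← zpow_mul, ← zpow_mul, ← zpow_mul]; congr 1; ring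
    have hj0 : j ≠ 0 := by
      rintro rfl
      apply hd (a * k) (mul_ne_zero ha0 (by exact_mod_cast hk.ne'))
      rw [zpow_mul, zpow_natCast, hj, zpow_zero]
      exact Subgroup.one_mem _
    apply ax.mal hf (mul_ne_zero hj0 hb0)
    rw [← h1]
    have := conj_zpow (i := a * k) (a := f⁻¹) (b := g ^ b)
    rw [inv_inv] at this
    rw [← this]
    exact E.zpow_mem hb _

theorem Axes.lemS (ax : Axes E v dd len C θ) {g : G} (hg : g ∉ E.normalCore) (y : G) (B : ℝ) :
    ∃ s, IsConj g s ∧ ∀ k : ℤ, s ^ k ∉ E.normalCore → ∀ a, dd y 1 a ≤ B → B < dd y 1 (s ^ k * a) := by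
  have hKn : E.normalCore.Normal := inferInstance
  obtain ⟨q, hq⟩ := ax.lemA hg
  obtain ⟨M, hM⟩ := ax.lemM (g := g) (q := q) (fun h => hg (by
    have := hq 1
    rw [zpow_one, mul_assoc] at this
    exact this h))
  obtain ⟨m, hm⟩ := exists_nat_gt (B + (M + (len q + C)) + 2 * θ + 2 * C + dd y 1 y + len q⁻¹)
  set t := y * v ^ m * q⁻¹ with ht
  have hty : t * q * (v ^ m)⁻¹ = y := by rw [ht]; group
  have hvm : (v ^ m)⁻¹ ∈ E := E.inv_mem (E.pow_mem ax.vmem m)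
  have htr : ∀ a b, dd y (t * a) (t * b) = dd q a b := by
    intro a b
    have h1 := ax.coset (t * q) (v ^ m)⁻¹ (t * a) (t * b) hvm
    rw [hty, ax.equi] at h1
    exact h1
  have hθ := ax.hθ
  have big : B + (M + (len q + C)) + 2 * θ < dd y 1 t := by
    have h1 := ax.lip y (y * v ^ m) q⁻¹
    have t1 := ax.tri y y 1 (y * v ^ m)
    have t2 := ax.tri y 1 t (y * v ^ m)
    have h2 := ax.equi y 1 1 (v ^ m)
    rw [mul_one] at h2
    have h3 := ax.growth m
    rw [← ht] at h1
    have c1 := ax.symm y y 1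
    have c2 := ax.symm y (y * v ^ m) t
    linarith
  refine ⟨t * g * t⁻¹, isConj_iff.2 ⟨t, rfl⟩, ?_⟩
  have hpow : ∀ k : ℤ, (t * g * t⁻¹) ^ k = t * g ^ k * t⁻¹ := fun k => conj_zpow
  have hgk : ∀ k : ℤ, (t * g * t⁻¹) ^ k ∉ E.normalCore → g ^ k ∉ E.normalCore := by
    intro k hk h
    apply hk
    rw [hpow]
    exact hKn.conj_mem _ h t
  have far : ∀ k : ℤ, (t * g * t⁻¹) ^ k ∉ E.normalCore → B + θ < dd y 1 ((t * g * t⁻¹) ^ k * y) := by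
    intro k hk
    have hk' := hgk k hk
    have e1 : (t * g * t⁻¹) ^ k * y = t * (g ^ k * q * (v ^ m)⁻¹) := by
      rw [hpow, ht]; group
    have h1 := htr 1 (g ^ k * q * (v ^ m)⁻¹)
    rw [mul_one, ← e1] at h1
    have t1 := ax.tri q 1 (g ^ k) (g ^ k * q)
    have t2 := ax.tri q 1 (g ^ k * q) (g ^ k * q * (v ^ m)⁻¹)
    have l1 := ax.lip q (g ^ k) q
    have s1 := ax.small q (g ^ k * q) (v ^ m)⁻¹ (by
      rw [← mul_assoc]; exact fun h => hk' (hq k h)) hvm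
    have t3 := ax.tri y 1 ((t * g * t⁻¹) ^ k * y) t
    have c := ax.symm y ((t * g * t⁻¹) ^ k * y) t
    have := hM k
    linarith
  intro k hk a ha
  set x := (t * g * t⁻¹) ^ k with hx
  have hxinv : x⁻¹ = (t * g * t⁻¹) ^ (-k) := by rw [hx, zpow_neg]
  have hk2 : (t * g * t⁻¹) ^ (-k) ∉ E.normalCore := by
    rw [← hxinv]; exact fun h => hk (by have := Subgroup.inv_mem _ h; rwa [inv_inv] at this)
  have hne : y⁻¹ * (x⁻¹ * y) ∉ E := by
    rw [hxinv, hpow]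
    intro h
    apply hgk _ hk2
    apply hq
    have : q⁻¹ * g ^ (-k) * q = (v ^ m)⁻¹ * (y⁻¹ * (t * g ^ (-k) * t⁻¹ * y)) * ((v ^ m)⁻¹)⁻¹ := by
      rw [ht]; group
    rw [this]
    exact E.mul_mem (E.mul_mem hvm h) (E.inv_mem hvm)
  rcases ax.behr y (x⁻¹ * y) a hne with h | h
  · have := far _ hk2
    rw [← hxinv] at this
    have := ax.tri y 1 a (x⁻¹ * y)
    linarith
  · have e := ax.equi x (x⁻¹ * y) a y
    rw [mul_inv_cancel_left] at e
    have := far k hk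
    have := ax.tri y 1 (x * a) (x * y)
    linarith

theorem Axes.final (ax : Axes E v dd len C θ) :
    ∃ H : Subgroup G, H ≠ ⊤ ∧ ∀ g : G, ∃ h ∈ H, IsConj g h := by
  classical
  have hθ := ax.hθ
  have hC := ax.hC
  have hKE : E.normalCore ≤ E := Subgroup.normalCore_le E
  obtain ⟨code, hcode⟩ := Set.countable_iff_exists_injOn.1 ax.countable
  let rep : G → G := fun g => Quotient.out (QuotientGroup.mk g : G ⧸ E)
  have hrep : ∀ g, (rep g)⁻¹ * g ∈ E := by
    intro g
    rw [← QuotientGroup.eq]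
    exact QuotientGroup.out_eq' _
  let l : G → ℕ := fun g => Nat.pair ⌈len g⌉₊ (code ((rep g)⁻¹ * g))
  have hl : ∀ g, len g ≤ l g := by
    intro g
    have h1 := Nat.le_ceil (len g)
    have h2 : ((⌈len g⌉₊ : ℕ) : ℝ) ≤ l g := by exact_mod_cast Nat.left_le_pair _ _
    linarith
  have hinj : ∀ g g', g⁻¹ * g' ∈ E → l g = l g' → g = g' := by
    intro g g' h1 h2
    have h3 := (Nat.pair_eq_pair.1 h2).2
    have h4 : rep g = rep g' := by
      show Quotient.out _ = Quotient.out _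
      rw [QuotientGroup.eq.2 h1]
    have := hcode (hrep g) (hrep g') h3
    rw [h4] at this
    exact mul_left_cancel this
  obtain ⟨A, hA⟩ := exists_nat_gt (3 * C + θ + 1)
  let z : G → G := fun g => v ^ (A * (l g + 1) ^ 2)
  have hzE : ∀ g, z g ∈ E := fun g => E.pow_mem ax.vmem _
  have hz : ∀ g g', l g ≠ l g' → l g + l g' + 2 * C + θ < dd 1 (z g) (z g') := by
    have main : ∀ g g', l g < l g' → l g + l g' + 2 * C + θ < dd 1 (z g) (z g') := by
      intro g g' hlt
      have h1 := ax.growth2 ((A * (l g + 1) ^ 2 : ℕ) : ℤ) ((A * (l g' + 1) ^ 2 : ℕ) : ℤ)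
      rw [zpow_natCast, zpow_natCast] at h1
      have h2 := (le_abs_self _).trans h1
      have h3 : (l g : ℝ) + 1 ≤ l g' := by exact_mod_cast hlt
      have h0 : (0 : ℝ) ≤ l g := by positivity
      push_cast at h2
      have h4 : (l g : ℝ) + l g' + 2 ≤ (l g' + 1) ^ 2 - (l g + 1) ^ 2 := by nlinarith
      have h5 : (A : ℝ) * (l g + l g' + 2) ≤ A * ((l g' + 1) ^ 2 - (l g + 1) ^ 2) :=
        mul_le_mul_of_nonneg_left h4 (by positivity)
      have h6 : (1:ℝ) ≤ A := by linarith
      have h7 : (l g : ℝ) + l g' + A ≤ A * (l g + l g' + 2) := by nlinarith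
      show _ < dd 1 (v ^ (A * (l g + 1) ^ 2)) (v ^ (A * (l g' + 1) ^ 2))
      linarith
    intro g g' hne
    rcases lt_or_gt_of_ne hne with h | h
    · exact main g g' h
    · have := main g' g h
      rw [ax.symm] at this
      linarith
  let I := {g : G // g ∉ E}
  let y : I → G := fun i => z i * i
  have hy : ∀ i, y i ∉ E := by
    intro i h
    apply i.2
    have : (i : G) = (z i)⁻¹ * y i := by simp [y]
    rw [this]
    exact E.mul_mem (E.inv_mem (hzE i)) h
  have hy1 : ∀ i, (1 : G)⁻¹ * y i ∉ E := fun i => by rw [inv_one, one_mul]; exact hy i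
  have hy2 : ∀ i, (y i)⁻¹ * 1 ∉ E := fun i h => hy i (by
    have := E.inv_mem h; simpa using this)
  have hzy : ∀ i : I, dd 1 (z i) (y i) ≤ l i + C := by
    intro i
    have := ax.lip 1 (z i) i
    have := hl i
    show dd 1 (z i) (z i * i) ≤ _
    linarith
  have hEy : ∀ i, ∀ e ∈ E, dd (y i) 1 e ≤ θ := by
    intro i e he
    have := ax.small (y i) 1 e (hy2 i) he
    rwa [one_mul] at this
  have farz : ∀ i j : I, l i ≠ l j → θ < dd 1 (y j) (y i) := by
    intro i j hij
    have h1 := hz i j hij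
    have h2 := hzy i
    have h3 := hzy j
    have t1 := ax.tri 1 (z i) (y i) (z j)
    have t2 := ax.tri 1 (y i) (y j) (z j)
    have c1 := ax.symm 1 (y j) (z j)
    have c2 := ax.symm 1 (y j) (y i)
    linarith
  have hdist : ∀ i j : I, i ≠ j → (y i)⁻¹ * y j ∉ E := by
    intro i j hij hmem
    by_cases hlij : l i = l j
    · apply hij
      apply Subtype.ext
      apply hinj _ _ _ hlij
      have : (i : G)⁻¹ * j = (y i)⁻¹ * y j := by
        have : z i = z j := by simp only [z, hlij]
        simp only [y, this]; group
      rwa [this]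
    · have := ax.small 1 (y i) _ (hy1 i) hmem
      rw [mul_inv_cancel_left, ax.symm] at this
      linarith [farz i j hlij]
  have hyy : ∀ i j : I, i ≠ j → dd (y i) 1 (y j) ≤ l i + C + θ := by
    intro i j hij
    have h0 : (0 : ℝ) ≤ l i := by positivity
    by_cases hlij : l i = l j
    · have t := ax.tri (y i) 1 (z j) (y j)
      have h1 := hEy i _ (hzE j)
      have h2 := ax.lip (y i) (z j) j
      have h3 := hl j
      rw [← hlij] at h3
      have h4 : dd (y i) (z j) (y j) ≤ len j + C := h2
      linarith
    · rcases ax.behr 1 (y i) (y j) (hy1 i) with h | h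
      · linarith [farz i j hlij]
      · rw [ax.symm]; linarith
  have hcore : ∀ i : I, (i : G) ∉ E.normalCore := fun i h => i.2 (hKE h)
  choose s hs1 hs2 using fun i : I => ax.lemS (hcore i) (y i) (l i + C + 2 * θ)
  have hv1 : v ∉ E.normalCore := by
    intro h
    obtain ⟨f, hf⟩ := ax.proper
    apply ax.mal hf (n := 1) one_ne_zero
    rw [zpow_one]
    exact mem_core_conj h f
  have hEU : ∀ i : I, ∀ e ∈ E, ¬ ((l i : ℝ) + C + 2 * θ < dd (y i) 1 e) := by
    intro i e he h
    have := hEy i e he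
    have h0 : (0 : ℝ) ≤ l i := by positivity
    linarith
  have pp := pingpong (K := E.normalCore) inferInstance (s := s)
    (U := fun i => {a | (l i : ℝ) + C + 2 * θ < dd (y i) 1 a}) (by
      intro i j a hi hj
      by_contra hij
      have hi : (l i : ℝ) + C + 2 * θ < dd (y i) 1 a := hi
      have hj : (l j : ℝ) + C + 2 * θ < dd (y j) 1 a := hj
      rcases ax.behr (y i) (y j) a (hdist i j hij) with h | h
      · have t := ax.tri (y i) 1 (y j) a
        have c := ax.symm (y i) (y j) a
        linarith [hyy i j hij]
      · have t := ax.tri (y j) 1 (y i) a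
        have c := ax.symm (y j) (y i) a
        linarith [hyy j i (Ne.symm hij)])
    (fun i κ hκ => hEU i κ (hKE hκ))
    (fun i k hk a ha => hs2 i k hk a (not_lt.1 ha)) v hv1 (fun i => hEU i v ax.vmem)
  refine ⟨Subgroup.closure ((E.normalCore : Set G) ∪ Set.range s), fun htop => pp (by rw [htop]; exact Subgroup.mem_top v), ?_⟩
  intro g
  by_cases hg : g ∈ E.normalCore
  · exact ⟨g, Subgroup.subset_closure (Or.inl hg), IsConj.refl g⟩
  · obtain ⟨b, hb⟩ : ∃ b : G, b * g * b⁻¹ ∉ E := by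
      by_contra hcon
      push Not at hcon
      exact hg hcon
    refine ⟨s ⟨_, hb⟩, Subgroup.subset_closure (Or.inr ⟨_, rfl⟩), ?_⟩
    exact IsConj.trans (isConj_iff.2 ⟨b, rfl⟩) (hs1 ⟨_, hb⟩)

end Final

end AHIG

open AHIG

theorem acylindrically_hyperbolic_not_invariably_generated
    (G : Type) [Group G] (hG : IsAcylindricallyHyperbolic G) :
    ∃ H : Subgroup G, H ≠ ⊤ ∧ ∀ g : G, ∃ h ∈ H, IsConj g h := by
  obtain ⟨hvc, X, _, δ, hδ, hgeo, hhyp, φ, hac, x, hub⟩ := hG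
  have hA : IsoAct G X (fun g x => φ g x) :=
    ⟨fun x => by simp, fun g h x => by simp, fun g x y => (φ g).dist_eq x y⟩
  have h4 := fourPt_of_slim hδ hgeo hhyp
  have hub' : ∀ B : ℝ, ∃ g : G, B < dist x (φ g x) := by
    intro B
    by_contra hcon
    push Not at hcon
    apply hub
    refine (Metric.isBounded_closedBall (x := x) (r := B)).subset ?_
    rintro _ ⟨g, rfl⟩
    rw [Metric.mem_closedBall, dist_comm]
    exact hcon g
  obtain ⟨w, y, hwy⟩ := exists_lox hA (δ := 10 * δ) (C₁ := 2 * (10 * δ) + 1) (by linarith)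
    (by linarith) h4 hgeo hac x hub'
  have hm : ∀ (g h : G) (x : X), φ (g * h) x = φ g (φ h x) := fun g h x => hA.mul g h x
  have hd : GMet (fun g h : G => dist (φ g y) (φ h y)) (10 * δ) := by
    refine ⟨fun x => dist_self _, fun x y => dist_comm _ _, fun x y z => dist_triangle _ _ _, ?_,
      by linarith, fun a b c e => h4 (φ a y) (φ b y) (φ c y) (φ e y), ?_⟩
    · intro g a b
      show dist (φ (g * a) y) (φ (g * b) y) = dist (φ a y) (φ b y)
      rw [hm, hm]
      exact (φ g).dist_eq _ _
    · intro R hR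
      obtain ⟨L, hL, N, hN⟩ := hac R hR
      refine ⟨L, hL, N, fun a b hab => ?_⟩
      have := hN (φ a y) (φ b y) hab
      simp only [hm]
      exact this
  have hw : Lox (fun g h : G => dist (φ g y) (φ h y)) (10 * δ) w := by
    show dist (φ 1 y) (φ w y) + (2 * (10 * δ) + 1) ≤ dist (φ 1 y) (φ (w * w) y)
    have : φ 1 y = y := hA.one y
    rw [this]
    exact hwy
  obtain ⟨E, v, dd, len, C, θ, ax⟩ := exists_axes hd hw hvc
  exact ax.final
end

section
/- Suppose a group G acts by automorphisms on a simplicial tree X and there is a constant K such that the stabilizer of every edge of X has at most K elements. Then the action of G on the vertex set of X with the path metric is acylindrical; more precisely, for every integer R > 0 there exists L > 0 such that for all vertices v, w with d(v, w) ≥ L, there are at most (2R+1)·K elements g ∈ G with d(v, g·v) ≤ R and d(w, g·w) ≤ R. -/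
open SimpleGraph in
lemma geod_getVert {V : Type} {X : SimpleGraph V} (hc : X.Connected) {a b : V} (p : X.Walk a b)
    (hp : p.length = X.dist a b) (i : ℕ) (hi : i ≤ p.length) :
    X.dist a (p.getVert i) = i ∧ X.dist a (p.getVert i) + X.dist (p.getVert i) b = X.dist a b := by
  have h1 := dist_le (p.take i)
  have h2 := dist_le (p.drop i)
  have h3 : X.dist a b ≤ X.dist a (p.getVert i) + X.dist (p.getVert i) b := hc.dist_triangle
  rw [Walk.take_length] at h1
  rw [Walk.drop_length] at h2
  omega

open SimpleGraph in
lemma between_mem_support {V : Type} {X : SimpleGraph V} (ht : X.IsTree) {a b x : V}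
    (hx : X.dist a x + X.dist x b = X.dist a b) (q : X.Walk a b) : x ∈ q.support := by
  classical
  obtain ⟨p1, h1⟩ := ht.connected.exists_walk_length_eq_dist a x
  obtain ⟨p2, h2⟩ := ht.connected.exists_walk_length_eq_dist x b
  have hp : (p1.append p2).IsPath := Walk.isPath_of_length_eq_dist _ (by
    rw [Walk.length_append]; omega)
  have heq := (ht.existsUnique_path a b).unique hp q.bypass_isPath
  apply q.support_bypass_subset_support
  rw [← heq, Walk.mem_support_append_iff]
  exact Or.inl p1.end_mem_support

open SimpleGraph in
lemma between_getVert {V : Type} {X : SimpleGraph V} (ht : X.IsTree) {a b x : V}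
    (hx : X.dist a x + X.dist x b = X.dist a b) (p : X.Walk a b) (hp : p.length = X.dist a b) :
    p.getVert (X.dist a x) = x := by
  obtain ⟨k, hk, hkl⟩ := Walk.mem_support_iff_exists_getVert.1 (between_mem_support ht hx p)
  have := (geod_getVert ht.connected p hp k hkl).1
  rw [hk] at this
  rw [this, hk]

open SimpleGraph in
lemma between_or {V : Type} {X : SimpleGraph V} (ht : X.IsTree) {a b x : V} (c : V)
    (hx : X.dist a x + X.dist x b = X.dist a b) :
    X.dist a x + X.dist x c = X.dist a c ∨ X.dist c x + X.dist x b = X.dist c b := by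
  obtain ⟨p1, h1⟩ := ht.connected.exists_walk_length_eq_dist a c
  obtain ⟨p2, h2⟩ := ht.connected.exists_walk_length_eq_dist c b
  have h := between_mem_support ht hx (p1.append p2)
  rw [Walk.mem_support_append_iff] at h
  refine h.imp (fun h => ?_) (fun h => ?_)
  · obtain ⟨k, hk, hkl⟩ := Walk.mem_support_iff_exists_getVert.1 h
    have := (geod_getVert ht.connected p1 h1 k hkl).2
    rwa [hk] at this
  · obtain ⟨k, hk, hkl⟩ := Walk.mem_support_iff_exists_getVert.1 h
    have := (geod_getVert ht.connected p2 h2 k hkl).2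
    rwa [hk] at this

open SimpleGraph in
lemma graph_dist_smul_le {G V : Type} [Group G] [MulAction G V] {X : SimpleGraph V}
    (hc : X.Connected)
    (hadj : ∀ (g : G) (u v : V), X.Adj u v ↔ X.Adj (g • u) (g • v)) (g : G) (a b : V) :
    X.dist (g • a) (g • b) ≤ X.dist a b := by
  obtain ⟨p, hp⟩ := hc.exists_walk_length_eq_dist a b
  let f : X →g X := ⟨fun v => g • v, fun {u v} h => (hadj g u v).1 h⟩
  have h := dist_le (p.map f)
  rw [Walk.length_map, hp] at h
  exact h

lemma dist_smul_eq {G V : Type} [Group G] [MulAction G V] {X : SimpleGraph V}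
    (hc : X.Connected)
    (hadj : ∀ (g : G) (u v : V), X.Adj u v ↔ X.Adj (g • u) (g • v)) (g : G) (a b : V) :
    X.dist (g • a) (g • b) = X.dist a b := by
  apply le_antisymm (graph_dist_smul_le hc hadj g a b)
  simpa using graph_dist_smul_le hc hadj g⁻¹ (g • a) (g • b)

lemma transporter_card {G V : Type} [Group G] [MulAction G V] (e f : Sym2 V) (K : ℕ)
    (h : {g : G | Sym2.map (fun v => g • v) e = e}.Finite ∧
      {g : G | Sym2.map (fun v => g • v) e = e}.ncard ≤ K) :
    {g : G | Sym2.map (fun v => g • v) e = f}.Finite ∧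
      {g : G | Sym2.map (fun v => g • v) e = f}.ncard ≤ K := by
  rcases Set.eq_empty_or_nonempty {g : G | Sym2.map (fun v => g • v) e = f} with h0 | ⟨g0, hg0⟩
  · rw [h0]; simp
  · have hm : ∀ g ∈ {g : G | Sym2.map (fun v => g • v) e = f},
        g0⁻¹ * g ∈ {g : G | Sym2.map (fun v => g • v) e = e} := by
      intro g hg
      simp only [Set.mem_setOf_eq] at hg hg0 ⊢
      have : (fun v : V => (g0⁻¹ * g) • v) = (fun v => g0⁻¹ • v) ∘ (fun v => g • v) := by
        ext v; simp [mul_smul]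
      rw [this, ← Sym2.map_map, hg, ← hg0, Sym2.map_map]
      have : (fun v : V => g0⁻¹ • v) ∘ (fun v => g0 • v) = id := by
        ext v; simp
      rw [this, Sym2.map_id, id]
    have hi : Set.InjOn (fun g => g0⁻¹ * g) {g : G | Sym2.map (fun v => g • v) e = f} :=
      fun a _ b _ hab => mul_left_cancel hab
    exact ⟨Set.Finite.of_injOn hm hi h.1, (Set.ncard_le_ncard_of_injOn _ hm hi h.1).trans h.2⟩

open SimpleGraph in
lemma image_between {G V : Type} [Group G] [MulAction G V] {X : SimpleGraph V}
    (ht : X.IsTree)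
    (hadj : ∀ (g : G) (u v : V), X.Adj u v ↔ X.Adj (g • u) (g • v)) (g : G) (v w x : V) (R : ℕ)
    (hv : X.dist v (g • v) ≤ R) (hw : X.dist w (g • w) ≤ R)
    (hx : X.dist v x + X.dist x w = X.dist v w) (h1 : R < X.dist v x) (h2 : R < X.dist x w) :
    X.dist v (g • x) + X.dist (g • x) w = X.dist v w ∧
      X.dist v (g • x) ≤ X.dist v x + R ∧ X.dist v x ≤ X.dist v (g • x) + R := by
  have e1 := dist_smul_eq ht.connected hadj g v x
  have e2 := dist_smul_eq ht.connected hadj g x w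
  have e3 := dist_smul_eq ht.connected hadj g v w
  have c1 : X.dist (g • v) v = X.dist v (g • v) := dist_comm
  have t1 : X.dist v (g • x) ≤ X.dist v (g • v) + X.dist (g • v) (g • x) :=
    ht.connected.dist_triangle
  have t2 : X.dist (g • v) (g • x) ≤ X.dist (g • v) v + X.dist v (g • x) :=
    ht.connected.dist_triangle
  refine ⟨?_, by omega, by omega⟩
  rcases between_or ht v (show X.dist (g • v) (g • x) + X.dist (g • x) (g • w)
      = X.dist (g • v) (g • w) by omega) with h | h
  · omega
  rcases between_or ht w h with h' | h'
  · exact h'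
  · omega

theorem tree_action_acylindrical_of_bounded_edge_stabilizers
    {G V : Type} [Group G] [MulAction G V] (X : SimpleGraph V)
    (htree : X.IsTree)
    (hadj : ∀ (g : G) (u v : V), X.Adj u v ↔ X.Adj (g • u) (g • v))
    (K : ℕ)
    (hedge : ∀ e ∈ X.edgeSet,
      {g : G | Sym2.map (fun v => g • v) e = e}.Finite ∧
      {g : G | Sym2.map (fun v => g • v) e = e}.ncard ≤ K) :
    ∀ R : ℕ, 0 < R → ∃ L : ℕ, 0 < L ∧ ∀ v w : V, L ≤ X.dist v w →
      {g : G | X.dist v (g • v) ≤ R ∧ X.dist w (g • w) ≤ R}.Finite ∧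
      {g : G | X.dist v (g • v) ≤ R ∧ X.dist w (g • w) ≤ R}.ncard ≤ (2 * R + 1) * K := by

  intro R hR
  refine ⟨2 * R + 3, by omega, fun v w hL => ?_⟩
  obtain ⟨p, hp⟩ := htree.connected.exists_walk_length_eq_dist v w
  have hx := geod_getVert htree.connected p hp (R + 1) (by omega)
  have hy := geod_getVert htree.connected p hp (R + 2) (by omega)
  have hxy : X.Adj (p.getVert (R + 1)) (p.getVert (R + 2)) :=
    p.adj_getVert_succ (by omega)
  generalize p.getVert (R + 1) = x at hx hxy
  generalize p.getVert (R + 2) = y at hy hxy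
  have key := fun f => transporter_card (G := G) s(x, y) f K (hedge s(x, y) hxy)
  have hsub : {g : G | X.dist v (g • v) ≤ R ∧ X.dist w (g • w) ≤ R} ⊆
      ⋃ k ∈ Finset.Icc 1 (2 * R + 1), {g : G | Sym2.map (fun v => g • v) s(x, y) =
        s(p.getVert k, p.getVert (k + 1))} := by
    rintro g ⟨hv, hw⟩
    obtain ⟨a1, a2, a3⟩ := image_between htree hadj g v w x R hv hw hx.2 (by omega) (by omega)
    obtain ⟨b1, b2, b3⟩ := image_between htree hadj g v w y R hv hw hy.2 (by omega) (by omega)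
    have a4 := between_getVert htree a1 p hp
    have b4 := between_getVert htree b1 p hp
    have hg := (hadj g x y).1 hxy
    have d1 : X.dist (g • x) (g • y) = 1 := SimpleGraph.dist_eq_one_iff_adj.2 hg
    have d2 : X.dist (g • y) (g • x) = 1 := SimpleGraph.dist_eq_one_iff_adj.2 hg.symm
    have t1 : X.dist v (g • y) ≤ X.dist v (g • x) + X.dist (g • x) (g • y) :=
      htree.connected.dist_triangle
    have t2 : X.dist v (g • x) ≤ X.dist v (g • y) + X.dist (g • y) (g • x) :=
      htree.connected.dist_triangle
    have hne : X.dist v (g • x) ≠ X.dist v (g • y) := by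
      intro h
      rw [h, b4] at a4
      exact hg.ne a4.symm
    simp only [Set.mem_iUnion, Finset.mem_Icc, Set.mem_setOf_eq, Sym2.map_mk]
    rcases lt_or_gt_of_ne hne with h | h
    · refine ⟨X.dist v (g • x), by omega, ?_⟩
      rw [show X.dist v (g • x) + 1 = X.dist v (g • y) by omega, a4, b4]
    · refine ⟨X.dist v (g • y), by omega, ?_⟩
      rw [show X.dist v (g • y) + 1 = X.dist v (g • x) by omega, a4, b4, Sym2.eq_swap]
  have hfin : (⋃ k ∈ Finset.Icc 1 (2 * R + 1), {g : G | Sym2.map (fun v => g • v) s(x, y) =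
        s(p.getVert k, p.getVert (k + 1))}).Finite :=
    Set.Finite.biUnion (Finset.finite_toSet _) (fun k _ => (key _).1)
  refine ⟨hfin.subset hsub, (Set.ncard_le_ncard hsub hfin).trans
    ((Finset.set_ncard_biUnion_le _ _).trans ?_)⟩
  refine (Finset.sum_le_card_nsmul _ _ K (fun k _ => (key _).2)).trans ?_
  simp
end

section
/- Let X be a δ-hyperbolic geodesic metric space and let A, B ⊆ X be Q-quasi-convex subsets. Let γ be a shortest geodesic between A and B. Then for any point x ∈ γ with d(x, A) > Q + 2δ and d(x, B) > Q + 2δ, and for any shortest geodesic τ between A and B, we have d(x, τ) ≤ 2δ. -/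
def IsShortestGeodesicBetween {X : Type} [MetricSpace X]
    (A B : Set X) (a b : X) (γ : ℝ → X) : Prop :=
  a ∈ A ∧ b ∈ B ∧ IsGeodesicFrom a b γ ∧ ∀ a' ∈ A, ∀ b' ∈ B, dist a b ≤ dist a' b'

theorem shortest_geodesics_fellow_travel
    {X : Type} [MetricSpace X] (δ Q : ℝ) (hδ : 0 < δ) (hQ : 0 < Q)
    (hgeo : IsGeodesicSpace X) (hhyp : IsDeltaHyperbolic X δ)
    (A B : Set X) (hA : QuasiConvexSet Q A) (hB : QuasiConvexSet Q B)
    (a b : X) (γ : ℝ → X) (hγ : IsShortestGeodesicBetween A B a b γ)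
    (x : X) (hx : x ∈ geoImage a b γ)
    (hxA : Q + 2 * δ < Metric.infDist x A) (hxB : Q + 2 * δ < Metric.infDist x B)
    (a' b' : X) (τ : ℝ → X) (hτ : IsShortestGeodesicBetween A B a' b' τ) :
    Metric.infDist x (geoImage a' b' τ) ≤ 2 * δ := by
  obtain ⟨ha, hb, hγg, -⟩ := hγ
  obtain ⟨ha', hb', hτg, -⟩ := hτ
  obtain ⟨σ, hσ⟩ := hgeo a b'
  obtain ⟨β, hβ⟩ := hgeo b' b
  obtain ⟨α, hα⟩ := hgeo a a'
  obtain ⟨q, hq | hq, hxq⟩ := hhyp a b' b σ β γ hσ hβ hγg x hx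
  · obtain ⟨r, hr | hr, hqr⟩ := hhyp a a' b' α τ σ hα hτg hσ q hq
    · obtain ⟨c, hc, hrc⟩ := hA a ha a' ha' α hα r hr
      have h1 := Metric.infDist_le_dist_of_mem (x := x) hc
      have h2 := dist_triangle4 x q r c
      linarith
    · have h1 := Metric.infDist_le_dist_of_mem (x := x) hr
      have h2 := dist_triangle x q r
      linarith
  · obtain ⟨c, hc, hqc⟩ := hB b' hb' b hb β hβ q hq
    have h1 := Metric.infDist_le_dist_of_mem (x := x) hc
    have h2 := dist_triangle x q c
    linarith
end

section
/- Let X be a δ-hyperbolic geodesic metric space, let A ⊆ X be a Q-quasi-convex subset, and suppose f is an isometry of X with f(A) = A. Let x ∈ X \ A and let σ be a shortest geodesic from x to A. Let N be a positive integer and assume d(x, A) ≥ Q + 4δN and d(x, f(x)) ≤ 4δ. Then for every point y ∈ σ with Q + 2δ < d(y, A) < d(x, A) − 4δN − 2δ, we have d(y, f^i(y)) ≤ 4δ for all integers i with 1 ≤ i ≤ N. -/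
/-- `σ` is a shortest geodesic from the point `x` to the subset `A`: a geodesic from
`x` to a point `a ∈ A` whose length realizes `d(x, A)`. -/
def IsShortestGeodesicToSet {X : Type} [MetricSpace X]
    (x : X) (A : Set X) (a : X) (σ : ℝ → X) : Prop :=
  a ∈ A ∧ IsGeodesicFrom x a σ ∧ ∀ a' ∈ A, dist x a ≤ dist x a'

theorem pml_infDist_geodesic {X : Type} [MetricSpace X] {A : Set X} {x a : X} {σ : ℝ → X}
    (hσ : IsShortestGeodesicToSet x A a σ) (t : ℝ) (ht : t ∈ Set.Icc (0 : ℝ) (dist x a)) :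
    Metric.infDist (σ t) A = dist x a - t := by
  obtain ⟨ha, ⟨h0, h1, hd⟩, hmin⟩ := hσ
  have hx : dist x a ≤ Metric.infDist x A :=
    (Metric.le_infDist ⟨a, ha⟩).2 (fun {b} hb => hmin b hb)
  have hL : dist x a ∈ Set.Icc (0 : ℝ) (dist x a) := ⟨dist_nonneg, le_rfl⟩
  have hZ : (0 : ℝ) ∈ Set.Icc (0 : ℝ) (dist x a) := ⟨le_rfl, dist_nonneg⟩
  have e1 := hd t ht _ hL
  have e2 := hd 0 hZ t ht
  rw [h1, abs_of_nonpos (by linarith [ht.2])] at e1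
  rw [h0, abs_of_nonpos (by linarith [ht.1])] at e2
  have := Metric.infDist_le_dist_of_mem (x := σ t) ha
  have := Metric.infDist_le_infDist_add_dist (s := A) (x := x) (y := σ t)
  linarith

theorem pml_pow_image {X : Type} [MetricSpace X] {A : Set X} (f : X ≃ᵢ X)
    (hfA : (f : X → X) '' A = A) (i : ℕ) : ((f ^ i : X ≃ᵢ X) : X → X) '' A = A := by
  induction i with
  | zero => simp
  | succ n ih =>
    have : ((f ^ (n + 1) : X ≃ᵢ X) : X → X) = (f ^ n : X ≃ᵢ X) ∘ f := by
      funext z; rw [pow_succ]; rfl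
    rw [this, Set.image_comp, hfA, ih]

theorem pml_pow_dist {X : Type} [MetricSpace X] (f : X ≃ᵢ X) (x : X) (c : ℝ)
    (h : dist x (f x) ≤ c) (i : ℕ) : dist x ((f ^ i) x) ≤ c * i := by
  induction i with
  | zero => simp
  | succ n ih =>
    have e : (f ^ (n + 1)) x = (f ^ n) (f x) := by rw [pow_succ]; rfl
    have h2 : dist ((f ^ n) x) ((f ^ n) (f x)) = dist x (f x) := (f ^ n).isometry.dist_eq _ _
    have := dist_triangle x ((f ^ n) x) ((f ^ n) (f x))
    rw [e]; push_cast; linarith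

theorem powers_move_little_along_projection_geodesic
    {X : Type} [MetricSpace X] (δ Q : ℝ) (hδ : 0 < δ) (hQ : 0 < Q)
    (hgeo : IsGeodesicSpace X) (hhyp : IsDeltaHyperbolic X δ)
    (A : Set X) (hA : QuasiConvexSet Q A)
    (f : X ≃ᵢ X) (hfA : (f : X → X) '' A = A)
    (x : X) (hxA : x ∉ A)
    (a : X) (σ : ℝ → X) (hσ : IsShortestGeodesicToSet x A a σ)
    (N : ℕ) (hN : 0 < N)
    (hfar : Q + 4 * δ * N ≤ Metric.infDist x A)
    (hmove : dist x (f x) ≤ 4 * δ) :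
    ∀ y ∈ geoImage x a σ,
      Q + 2 * δ < Metric.infDist y A →
      Metric.infDist y A < Metric.infDist x A - 4 * δ * N - 2 * δ →
      ∀ i : ℕ, 1 ≤ i → i ≤ N → dist y ((f ^ i) y) ≤ 4 * δ := by
  rintro y ⟨t, ht, rfl⟩ hlow hup i _ hi
  obtain ⟨ha, hg, hmin⟩ := id hσ
  have hZ : (0 : ℝ) ∈ Set.Icc (0 : ℝ) (dist x a) := ⟨le_rfl, dist_nonneg⟩
  have hxd := pml_infDist_geodesic hσ 0 hZ
  rw [hg.1] at hxd
  have hyd := pml_infDist_geodesic hσ t ht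
  have hgA := pml_pow_image f hfA i
  have hgx := pml_pow_dist f x _ hmove i
  have hiN : 4 * δ * (i : ℝ) ≤ 4 * δ * N := by
    have : (i : ℝ) ≤ N := by exact_mod_cast hi
    gcongr
  generalize f ^ i = g at *
  have hdist : dist (g x) (g a) = dist x a := g.isometry.dist_eq _ _
  have hga : g a ∈ A := hgA ▸ Set.mem_image_of_mem _ ha
  have hgg : IsGeodesicFrom (g x) (g a) (fun s => g (σ s)) := by
    refine ⟨by simp [hg.1], by simp [hdist, hg.2.1], ?_⟩
    rw [hdist]
    intro s hs u hu
    rw [g.isometry.dist_eq]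
    exact hg.2.2 s hs u hu
  obtain ⟨γ₁, h₁⟩ := hgeo x (g a)
  obtain ⟨γ₂, h₂⟩ := hgeo (g a) a
  obtain ⟨γ₃, h₃⟩ := hgeo x (g x)
  have hxy : dist x (σ t) = t := by
    have := hg.2.2 0 hZ t ht
    rwa [hg.1, abs_of_nonpos (by linarith [ht.1]), zero_sub, neg_neg] at this
  obtain ⟨p, hp, hpd⟩ := hhyp x (g a) a γ₁ γ₂ σ h₁ h₂ hg (σ t) ⟨t, ht, rfl⟩
  rcases hp with hp | hp
  · obtain ⟨q, hq, hqd⟩ := hhyp x (g x) (g a) γ₃ (fun s => g (σ s)) γ₁ h₃ hgg h₁ p hp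
    have hyq := dist_triangle (σ t) p q
    rcases hq with ⟨s, hs, rfl⟩ | ⟨s, hs, rfl⟩
    · exfalso
      have h4 := h₃.2.2 0 ⟨le_rfl, dist_nonneg⟩ s hs
      rw [h₃.1, abs_of_nonpos (by linarith [hs.1])] at h4
      have := dist_triangle_right x (σ t) (γ₃ s)
      linarith [hs.2]
    · rw [hdist] at hs
      have hq' : Metric.infDist (g (σ s)) A = dist x a - s := by
        rw [← pml_infDist_geodesic hσ s hs]
        conv_lhs => rw [← hgA]
        exact Metric.infDist_image g.isometry
      have l1 := Metric.infDist_le_infDist_add_dist (s := A) (x := σ t) (y := g (σ s))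
      have l2 := Metric.infDist_le_infDist_add_dist (s := A) (x := g (σ s)) (y := σ t)
      rw [dist_comm] at l2
      have h5 : dist (g (σ s)) (g (σ t)) = |s - t| := by
        rw [g.isometry.dist_eq]; exact hg.2.2 s hs t ht
      have h6 : |s - t| ≤ 2 * δ := by
        rw [abs_le]
        constructor <;> simp only at * <;> linarith
      have := dist_triangle (σ t) (g (σ s)) (g (σ t))
      simp only at *
      linarith
  · exfalso
    obtain ⟨b, hb, hbd⟩ := hA _ hga _ ha γ₂ h₂ p hp
    have := Metric.infDist_le_dist_of_mem (x := σ t) hb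
    have := dist_triangle (σ t) p b
    linarith
end

section
/- Let A and B be abelian groups containing elements a ∈ A and b ∈ B of finite orders greater than 1. Let G = A *_{⟨a⟩} (⟨a⟩ × ⟨b⟩) *_{⟨b⟩} B be the iterated amalgamated free product obtained by identifying the subgroup ⟨a⟩ of A with the factor ⟨a⟩ × 1 of ⟨a⟩ × ⟨b⟩, and the subgroup ⟨b⟩ of B with the factor 1 × ⟨b⟩. Then the canonical maps of A and B into G are injective, the images of A and B in G intersect trivially, the images of A and B generate G, and yet the induced homomorphism from the free product A * B onto G is not injective (indeed the images of a and b commute in G but not in A * B). -/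
/-- `(G, iA, iB)` is the amalgamated free product (pushout) of `f : H →* A` and
`g : H →* B`: the square commutes and it satisfies the universal property. -/
def IsAmalgamatedProduct {H A B G : Type} [Group H] [Group A] [Group B] [Group G]
    (f : H →* A) (g : H →* B) (iA : A →* G) (iB : B →* G) : Prop :=
  iA.comp f = iB.comp g ∧
    ∀ (K : Type) [Group K], ∀ (kA : A →* K) (kB : B →* K), kA.comp f = kB.comp g →
      ∃! φ : G →* K, φ.comp iA = kA ∧ φ.comp iB = kB

theorem amalgam_sup_range {H A B G : Type} [Group H] [Group A] [Group B] [Group G]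
    {f : H →* A} {g : H →* B} {iA : A →* G} {iB : B →* G}
    (h : IsAmalgamatedProduct f g iA iB) : iA.range ⊔ iB.range = ⊤ := by
  obtain ⟨hc, hu⟩ := h
  set S := iA.range ⊔ iB.range with hS
  have hA : ∀ x, iA x ∈ S := fun x => (le_sup_left : iA.range ≤ S) ⟨x, rfl⟩
  have hB : ∀ x, iB x ∈ S := fun x => (le_sup_right : iB.range ≤ S) ⟨x, rfl⟩
  obtain ⟨φ, ⟨h1, h2⟩, -⟩ := hu S (iA.codRestrict S hA) (iB.codRestrict S hB) (by
    ext x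
    exact DFunLike.congr_fun hc x)
  have key := (hu G iA iB hc).unique (y₁ := S.subtype.comp φ) (y₂ := MonoidHom.id G)
    ⟨by rw [MonoidHom.comp_assoc, h1]; rfl, by rw [MonoidHom.comp_assoc, h2]; rfl⟩ ⟨rfl, rfl⟩
  rw [eq_top_iff]
  intro x _
  have := DFunLike.congr_fun key x
  simp only [MonoidHom.comp_apply, MonoidHom.id_apply] at this
  rw [← this]
  exact (φ x).2

open Classical in
/-- `A` acts on `A × B`, by translation on `A × 1` and trivially elsewhere. -/
noncomputable def actLeft (A B : Type) [Group A] [Group B] : A →* Function.End (A × B) where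
  toFun x := fun p => if p.2 = 1 then (x * p.1, p.2) else p
  map_one' := by
    funext p
    obtain ⟨p1, p2⟩ := p
    change (if p2 = 1 then (1 * p1, p2) else (p1, p2)) = (p1, p2)
    simp
  map_mul' x y := by
    funext p
    change (if p.2 = 1 then ((x * y) * p.1, p.2) else p) =
      (fun p : A × B => if p.2 = 1 then (x * p.1, p.2) else p)
        (if p.2 = 1 then (y * p.1, p.2) else p)
    by_cases h : p.2 = 1 <;> simp [h, mul_assoc]

open Classical in
/-- `B` acts on `A × B`, by translation on `1 × B` and trivially elsewhere. -/
noncomputable def actRight (A B : Type) [Group A] [Group B] : B →* Function.End (A × B) where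
  toFun x := fun p => if p.1 = 1 then (p.1, x * p.2) else p
  map_one' := by
    funext p
    obtain ⟨p1, p2⟩ := p
    change (if p1 = 1 then (p1, 1 * p2) else (p1, p2)) = (p1, p2)
    simp
  map_mul' x y := by
    funext p
    change (if p.1 = 1 then (p.1, (x * y) * p.2) else p) =
      (fun p : A × B => if p.1 = 1 then (p.1, x * p.2) else p)
        (if p.1 = 1 then (p.1, y * p.2) else p)
    by_cases h : p.1 = 1 <;> simp [h, mul_assoc]

theorem coprod_not_commute {A B : Type} [Group A] [Group B] {a : A} {b : B}
    (ha : a ≠ 1) (hb : b ≠ 1) :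
    ¬ Commute ((Monoid.Coprod.inl : A →* Monoid.Coprod A B) a)
        ((Monoid.Coprod.inr : B →* Monoid.Coprod A B) b) := by
  intro h
  have h2 := h.map (Monoid.Coprod.lift (actLeft A B) (actRight A B))
  simp only [Monoid.Coprod.lift_apply_inl, Monoid.Coprod.lift_apply_inr] at h2
  have h3 := congrFun h2.eq ((1, 1) : A × B)
  have h4 : actLeft A B a (actRight A B b (1, 1)) = actRight A B b (actLeft A B a (1, 1)) := h3
  have l1 : actLeft A B a (1, 1) = (a, 1) := by
    refine (if_pos rfl).trans ?_
    simp
  have r1 : actRight A B b (1, 1) = (1, b) := by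
    refine (if_pos rfl).trans ?_
    simp
  have l2 : actLeft A B a (1, b) = (1, b) := if_neg hb
  have r2 : actRight A B b (a, 1) = (a, 1) := if_neg ha
  rw [l1, r1, l2, r2] at h4
  exact hb (congrArg Prod.snd h4)

theorem iterated_amalgam_not_free_product
    {A B : Type} [CommGroup A] [CommGroup B] (a : A) (b : B)
    (ha : 1 < orderOf a) (hb : 1 < orderOf b)
    -- `G₁ = A *_⟨a⟩ (⟨a⟩ × ⟨b⟩)`, amalgamating `⟨a⟩ ≤ A` with the factor `⟨a⟩ × 1`
    (G₁ : Type) [Group G₁] (iA : A →* G₁)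
    (iC : (↥(Subgroup.zpowers a) × ↥(Subgroup.zpowers b)) →* G₁)
    (hpush₁ : IsAmalgamatedProduct (Subgroup.zpowers a).subtype
      (MonoidHom.inl ↥(Subgroup.zpowers a) ↥(Subgroup.zpowers b)) iA iC)
    -- `G = G₁ *_⟨b⟩ B`, amalgamating the factor `1 × ⟨b⟩` with `⟨b⟩ ≤ B`
    (G : Type) [Group G] (j₁ : G₁ →* G) (jB : B →* G)
    (hpush₂ : IsAmalgamatedProduct
      (iC.comp (MonoidHom.inr ↥(Subgroup.zpowers a) ↥(Subgroup.zpowers b)))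
      (Subgroup.zpowers b).subtype j₁ jB) :
    -- the canonical maps of `A` and `B` into `G` are injective
    Function.Injective (j₁.comp iA) ∧ Function.Injective jB ∧
    -- the images of `A` and `B` in `G` intersect trivially
    (j₁.comp iA).range ⊓ jB.range = ⊥ ∧
    -- the images of `A` and `B` generate `G`
    (j₁.comp iA).range ⊔ jB.range = ⊤ ∧
    -- the images of `a` and `b` commute in `G`, but not in the free product `A ∗ B`
    Commute ((j₁.comp iA) a) (jB b) ∧
    ¬ Commute ((Monoid.Coprod.inl : A →* Monoid.Coprod A B) a)
        ((Monoid.Coprod.inr : B →* Monoid.Coprod A B) b) ∧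
    -- hence the induced homomorphism `A ∗ B →* G` is not injective
    ¬ Function.Injective (Monoid.Coprod.lift (j₁.comp iA) jB) := by
  have ha1 : a ≠ 1 := by rintro rfl; simp at ha
  have hb1 : b ≠ 1 := by rintro rfl; simp at hb
  have hnc := coprod_not_commute ha1 hb1
  obtain ⟨φ₁, ⟨h1, h2⟩, -⟩ := hpush₁.2 (A × B) (MonoidHom.inl A B)
    (MonoidHom.prodMap (Subgroup.zpowers a).subtype (Subgroup.zpowers b).subtype)
    (by ext x <;> simp)
  obtain ⟨φ, ⟨h3, h4⟩, -⟩ := hpush₂.2 (A × B) φ₁ (MonoidHom.inr A B) (by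
    rw [← MonoidHom.comp_assoc, h2]
    ext x <;> simp)
  have eA : ∀ x, φ (j₁ (iA x)) = (x, 1) := fun x => by
    have e := DFunLike.congr_fun h3 (iA x)
    have e' := DFunLike.congr_fun h1 x
    simp only [MonoidHom.comp_apply, MonoidHom.inl_apply] at e e'
    rw [e, e']
  have eB : ∀ x, φ (jB x) = (1, x) := fun x => DFunLike.congr_fun h4 x
  have cb : ∀ y : Subgroup.zpowers b, j₁ (iC (1, y)) = jB y := fun y =>
    DFunLike.congr_fun hpush₂.1 y
  have ca : ∀ y : Subgroup.zpowers a, iA y = iC (y, 1) := fun y =>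
    DFunLike.congr_fun hpush₁.1 y
  have hcomm : Commute ((j₁.comp iA) a) (jB b) := by
    have e1 := ca ⟨a, Subgroup.mem_zpowers a⟩
    have e2 := cb ⟨b, Subgroup.mem_zpowers b⟩
    simp only at e1 e2
    rw [MonoidHom.comp_apply, e1, ← e2]
    refine Commute.map (Commute.map ?_ iC) j₁
    simp [Commute, SemiconjBy]
  refine ⟨?_, ?_, ?_, ?_, hcomm, hnc, ?_⟩
  · intro x y hxy
    have := congrArg φ hxy
    simp only [MonoidHom.comp_apply, eA] at this
    exact congrArg Prod.fst this
  · intro x y hxy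
    have := congrArg φ hxy
    simp only [eB] at this
    exact congrArg Prod.snd this
  · rw [eq_bot_iff]
    rintro g ⟨⟨x, rfl⟩, ⟨y, hy⟩⟩
    have := congrArg φ hy
    simp only [MonoidHom.comp_apply, eA, eB] at this
    have hx : x = 1 := (congrArg Prod.fst this).symm
    simp [hx]
  · rw [eq_top_iff, ← amalgam_sup_range hpush₂]
    refine sup_le ?_ le_sup_right
    rw [MonoidHom.range_eq_map, ← amalgam_sup_range hpush₁, Subgroup.map_sup]
    refine sup_le ?_ ?_
    · rw [MonoidHom.map_range]
      exact le_sup_left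
    · rintro _ ⟨_, ⟨⟨x, y⟩, rfl⟩, rfl⟩
      have e : (x, y) = (x, 1) * ((1, y) : Subgroup.zpowers a × Subgroup.zpowers b) := by simp
      rw [e, map_mul, map_mul, cb, ← ca]
      exact Subgroup.mul_mem_sup ⟨x, rfl⟩ ⟨y, rfl⟩
  · intro hinj
    apply hnc
    apply hinj
    simpa using hcomm.eq
end

section
/- Let g be an isometry of a δ-hyperbolic geodesic metric space X (with δ > 0). If g has a bounded orbit, i.e. the set {g^n(x) : n ∈ ℤ} is bounded for some x ∈ X, then min(g) = inf_{p ∈ X} d(p, g(p)) ≤ 6δ. -/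
/-- The minimal translation length of an isometry `g`: `inf_p d(p, g p)`. -/
noncomputable def minTrans {X : Type} [MetricSpace X] (g : X ≃ᵢ X) : ℝ :=
  ⨅ p : X, dist p (g p)

lemma geoImage_dist_add {X : Type} [MetricSpace X] {x y : X} {γ : ℝ → X}
    (h : IsGeodesicFrom x y γ) {q : X} (hq : q ∈ geoImage x y γ) :
    dist x q + dist q y = dist x y := by
  obtain ⟨s, hs, rfl⟩ := hq
  obtain ⟨h0, h1, h2⟩ := h
  have a := h2 0 ⟨le_rfl, dist_nonneg⟩ s hs
  have b := h2 s hs (dist x y) ⟨dist_nonneg, le_rfl⟩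
  rw [h0, zero_sub, abs_neg, abs_of_nonneg hs.1] at a
  rw [h1, abs_of_nonpos (by linarith [hs.2])] at b
  linarith

theorem minTrans_le_of_bounded_orbit
    {X : Type} [MetricSpace X] (δ : ℝ) (hδ : 0 < δ)
    (hgeo : IsGeodesicSpace X) (hhyp : IsDeltaHyperbolic X δ)
    (g : X ≃ᵢ X) (x : X)
    (hbdd : Bornology.IsBounded (Set.range fun n : ℤ => (g ^ n) x)) :
    minTrans g ≤ 6 * δ := by
  set S : Set ℝ := {ρ | ∃ c : X, ∀ n : ℤ, dist c ((g ^ n) x) ≤ ρ} with hS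
  have hne : S.Nonempty := by
    obtain ⟨r, hr⟩ := hbdd.subset_closedBall x
    refine ⟨r, x, fun n => ?_⟩
    have := hr ⟨n, rfl⟩
    rw [Metric.mem_closedBall, dist_comm] at this
    exact this
  have hbb : BddBelow S := ⟨0, fun ρ ⟨c, hc⟩ => dist_nonneg.trans (hc 0)⟩
  obtain ⟨ρ, ⟨c, hc⟩, hρ⟩ := exists_lt_of_csInf_lt hne (lt_add_of_pos_right (sInf S) hδ)
  have hgc : ∀ n : ℤ, dist (g c) ((g ^ n) x) ≤ ρ := by
    intro n
    have h1 : (g ^ n) x = g ((g ^ (n - 1)) x) := by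
      rw [← IsometryEquiv.mul_apply, ← zpow_one_add]
      congr 2
      ring
    rw [h1, g.isometry.dist_eq]
    exact hc _
  obtain ⟨γ, hγ⟩ := hgeo c (g c)
  have hD : (0 : ℝ) ≤ dist c (g c) := dist_nonneg
  have hmid : dist c (g c) / 2 ∈ Set.Icc (0 : ℝ) (dist c (g c)) :=
    ⟨by linarith, by linarith⟩
  set m := γ (dist c (g c) / 2) with hm
  have hcm : dist c m = dist c (g c) / 2 := by
    have := hγ.2.2 0 ⟨le_rfl, hD⟩ _ hmid
    rwa [hγ.1, zero_sub, abs_neg, abs_of_nonneg hmid.1] at this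
  have hmI : m ∈ geoImage c (g c) γ := ⟨_, hmid, rfl⟩
  have hsum := geoImage_dist_add hγ hmI
  have hmem : ρ - dist c (g c) / 2 + 2 * δ ∈ S := by
    refine ⟨m, fun n => ?_⟩
    obtain ⟨γ₁, h₁⟩ := hgeo c ((g ^ n) x)
    obtain ⟨γ₂, h₂⟩ := hgeo ((g ^ n) x) (g c)
    obtain ⟨q, hq | hq, hmq⟩ := hhyp _ _ _ γ₁ γ₂ γ h₁ h₂ hγ m hmI
    · have e := geoImage_dist_add h₁ hq
      have t1 := dist_triangle m q ((g ^ n) x)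
      have t2 := dist_triangle_right c m q
      linarith [hc n]
    · have e := geoImage_dist_add h₂ hq
      have t1 := dist_triangle_right m ((g ^ n) x) q
      have t2 := dist_triangle m q (g c)
      have t3 := hgc n
      rw [dist_comm] at t3
      linarith
  have hle := csInf_le hbb hmem
  have hfin : minTrans g ≤ dist c (g c) :=
    ciInf_le ⟨0, by rintro _ ⟨p, rfl⟩; exact dist_nonneg⟩ c
  linarith
end

section
/- Let g be an isometry of a δ-hyperbolic geodesic metric space X (with δ > 0). If L ≥ min(g) + 1000δ, then the sublevel set X(g, L) = {x ∈ X : d(g(x), x) ≤ L} is 100δ-quasi-convex. -/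
theorem geo_mem_add {X : Type} [MetricSpace X] {x y : X} {γ : ℝ → X}
    (h : IsGeodesicFrom x y γ) {u : X} (hu : u ∈ geoImage x y γ) :
    dist x u + dist u y = dist x y := by
  obtain ⟨h0, h1, h2⟩ := h
  obtain ⟨s, hs, rfl⟩ := hu
  have hR : (0 : ℝ) ≤ dist x y := dist_nonneg
  have e1 := h2 0 ⟨le_refl _, hR⟩ s hs
  have e2 := h2 s hs (dist x y) ⟨hR, le_refl _⟩
  rw [h0] at e1
  rw [h1] at e2
  rw [e1, e2, abs_of_nonpos (by linarith [hs.1]), abs_of_nonpos (by linarith [hs.2])]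
  ring

theorem geo_mem_dist {X : Type} [MetricSpace X] {x y : X} {γ : ℝ → X}
    (h : IsGeodesicFrom x y γ) {u v : X} (hu : u ∈ geoImage x y γ) (hv : v ∈ geoImage x y γ) :
    dist u v = |dist x u - dist x v| := by
  obtain ⟨h0, h1, h2⟩ := h
  obtain ⟨s, hs, rfl⟩ := hu
  obtain ⟨t, ht, rfl⟩ := hv
  have hR : (0 : ℝ) ≤ dist x y := dist_nonneg
  have e1 := h2 0 ⟨le_refl _, hR⟩ s hs
  have e2 := h2 0 ⟨le_refl _, hR⟩ t ht
  rw [h0] at e1 e2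
  rw [e1, e2, h2 s hs t ht, abs_of_nonpos (by linarith [hs.1] : 0 - s ≤ 0),
    abs_of_nonpos (by linarith [ht.1] : 0 - t ≤ 0)]
  congr 1
  ring

theorem geo_reverse {X : Type} [MetricSpace X] {x y : X} {γ : ℝ → X}
    (h : IsGeodesicFrom x y γ) :
    IsGeodesicFrom y x (fun s => γ (dist x y - s)) := by
  obtain ⟨h0, h1, h2⟩ := h
  refine ⟨by simpa using h1, by simpa [dist_comm y x] using h0, ?_⟩
  intro s hs t ht
  rw [dist_comm y x] at hs ht
  show dist (γ _) (γ _) = _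
  rw [h2 _ ⟨by linarith [hs.2], by linarith [hs.1]⟩ _ ⟨by linarith [ht.2], by linarith [ht.1]⟩,
    abs_sub_comm]
  congr 1
  ring

theorem geo_reverse_image {X : Type} [MetricSpace X] {x y : X} {γ : ℝ → X} {u : X}
    (hu : u ∈ geoImage y x (fun s => γ (dist x y - s))) : u ∈ geoImage x y γ := by
  obtain ⟨s, hs, rfl⟩ := hu
  rw [dist_comm y x] at hs
  exact ⟨_, ⟨by linarith [hs.2], by linarith [hs.1]⟩, rfl⟩

theorem geo_map {X : Type} [MetricSpace X] (g : X ≃ᵢ X) {x y : X} {γ : ℝ → X}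
    (h : IsGeodesicFrom x y γ) : IsGeodesicFrom (g x) (g y) (fun s => g (γ s)) := by
  obtain ⟨h0, h1, h2⟩ := h
  refine ⟨by simp [h0], by simp [g.dist_eq, h1], ?_⟩
  simpa [g.dist_eq] using h2

theorem geo_map_image {X : Type} [MetricSpace X] (g : X ≃ᵢ X) {x y : X} {γ : ℝ → X} {u : X}
    (hu : u ∈ geoImage x y γ) : g u ∈ geoImage (g x) (g y) (fun s => g (γ s)) := by
  obtain ⟨s, hs, rfl⟩ := hu
  exact ⟨s, by simpa [g.dist_eq] using hs, rfl⟩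

/-- The displacement function is quasi-convex along geodesics. -/
theorem displacement_quasiconvex
    {X : Type} [MetricSpace X] (δ : ℝ) (hδ : 0 < δ)
    (hgeo : IsGeodesicSpace X) (hhyp : IsDeltaHyperbolic X δ)
    (g : X ≃ᵢ X) (L : ℝ) (x y : X) (hx : dist (g x) x ≤ L) (hy : dist (g y) y ≤ L)
    (γ : ℝ → X) (hγ : IsGeodesicFrom x y γ) (p : X) (hp : p ∈ geoImage x y γ) :
    dist (g p) p ≤ L + 4 * δ := by
  obtain ⟨D, hD⟩ := hgeo x (g y)
  obtain ⟨A, hA⟩ := hgeo (g y) y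
  obtain ⟨B, hB⟩ := hgeo (g x) x
  have ep := geo_mem_add hγ hp
  have gxp : dist (g x) (g p) = dist x p := g.dist_eq x p
  have gpy : dist (g p) (g y) = dist p y := g.dist_eq p y
  have gxy : dist (g x) (g y) = dist x y := g.dist_eq x y
  obtain ⟨w, hw, hpw⟩ := hhyp x (g y) y D A γ hD hA hγ p hp
  obtain ⟨v, hv, hpv⟩ := hhyp (g x) x (g y) B D _ hB hD (geo_map g hγ) (g p) (geo_map_image g hp)
  have cpw := dist_comm p w
  rcases hw with hw | hw
  · rcases hv.symm with hv | hv
    · have e1 := geo_mem_add hD hw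
      have e2 := geo_mem_add hD hv
      have e3 := geo_mem_dist hD hw hv
      have a1 : dist w v ≤ L + 2 * δ := by
        rw [e3, abs_le]
        have t1 := dist_triangle x p w
        have t2 := dist_triangle x w p
        have t3 := dist_triangle (g p) v (g y)
        have t4 := dist_triangle v (g p) (g y)
        have t5 := dist_triangle x y (g y)
        have t6 := dist_triangle x (g y) y
        rw [dist_comm v (g p)] at t4
        rw [dist_comm y (g y)] at t5
        constructor <;> linarith
      have t1 := dist_triangle (g p) v p
      have t2 := dist_triangle v w p
      rw [dist_comm v w] at t2
      linarith
    · have e1 := geo_mem_add hB hv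
      have t1 := dist_triangle (g x) v (g p)
      have t2 := dist_triangle (g p) v x
      have t3 := dist_triangle (g p) x p
      rw [dist_comm v (g p)] at t1
      linarith
  · have e1 := geo_mem_add hA hw
    have t1 := dist_triangle p w y
    have t2 := dist_triangle (g y) w p
    have t3 := dist_triangle (g p) (g y) p
    linarith

/-- A point whose displacement is far from minimal can be moved to decrease the displacement. -/
theorem displacement_decrease
    {X : Type} [MetricSpace X] (δ : ℝ) (hδ : 0 < δ)
    (hgeo : IsGeodesicSpace X) (hhyp : IsDeltaHyperbolic X δ)
    (g : X ≃ᵢ X) (p q : X) (h : dist (g q) q + 999 * δ ≤ dist (g p) p) :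
    ∃ a, dist p a ≤ 100 * δ ∧ dist (g a) a ≤ dist (g p) p - 196 * δ := by
  obtain ⟨γ, hγ⟩ := hgeo p q
  obtain ⟨E, hE⟩ := hgeo p (g p)
  obtain ⟨A, hA⟩ := hgeo (g p) q
  obtain ⟨B, hB⟩ := hgeo p (g q)
  have gpq : dist (g p) (g q) = dist p q := g.dist_eq p q
  have cqp := dist_comm q p
  have cgp := dist_comm p (g p)
  have nq : 0 ≤ dist (g q) q := dist_nonneg
  have hR : 100 * δ ≤ dist p q := by
    have t1 := dist_triangle (g p) (g q) p
    have t2 := dist_triangle (g q) q p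
    linarith
  have ha : γ (100 * δ) ∈ geoImage p q γ := ⟨_, ⟨by linarith, hR⟩, rfl⟩
  have da : dist p (γ (100 * δ)) = 100 * δ := by
    have e := hγ.2.2 0 ⟨le_refl _, dist_nonneg⟩ (100 * δ) ⟨by linarith, hR⟩
    rw [hγ.1] at e
    rw [e, abs_of_nonpos (by linarith)]
    ring
  generalize γ (100 * δ) = a at ha da
  refine ⟨a, da.le, ?_⟩
  have ea := geo_mem_add hγ ha
  have gpa : dist (g p) (g a) = dist p a := g.dist_eq p a
  have gaq : dist (g a) (g q) = dist a q := g.dist_eq a q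
  obtain ⟨u, hu, hau⟩ := hhyp p (g p) q E A γ hE hA hγ a ha
  obtain ⟨v, hv, hav⟩ := hhyp (g p) p (g q) _ B _ (geo_reverse hE) hB (geo_map g hγ) (g a)
    (geo_map_image g ha)
  have cau := dist_comm a u
  have cav := dist_comm (g a) v
  rcases hu with hu | hu
  · rcases hv with hv | hv
    · have hv' := geo_reverse_image hv
      have e1 := geo_mem_add hE hu
      have e2 := geo_mem_add hE hv'
      have e3 := geo_mem_dist hE hu hv'
      have cv := dist_comm v (g p)
      have a1 : dist u v ≤ dist (g p) p - 198 * δ := by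
        rw [e3, abs_le]
        have t1 := dist_triangle p a u
        have t2 := dist_triangle p u a
        have t3 := dist_triangle (g p) v (g a)
        have t4 := dist_triangle (g p) (g a) v
        constructor <;> linarith
      have t1 := dist_triangle (g a) v a
      have t2 := dist_triangle v u a
      rw [dist_comm v u] at t2
      linarith
    · exfalso
      have e1 := geo_mem_add hB hv
      have t1 := dist_triangle p q (g q)
      have t2 := dist_triangle (g a) v (g q)
      have t3 := dist_triangle (g p) (g a) p
      have t4 := dist_triangle (g a) v p
      have c1 := dist_comm v p
      have c2 := dist_comm q (g q)
      linarith
  · exfalso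
    have e1 := geo_mem_add hA hu
    have t1 := dist_triangle (g p) (g q) q
    have t2 := dist_triangle a u q
    have t3 := dist_triangle (g p) u p
    have t4 := dist_triangle u a p
    have c1 := dist_comm a p
    linarith

theorem sublevel_set_quasiconvex
    {X : Type} [MetricSpace X] (δ : ℝ) (hδ : 0 < δ)
    (hgeo : IsGeodesicSpace X) (hhyp : IsDeltaHyperbolic X δ)
    (g : X ≃ᵢ X) (L : ℝ) (hL : minTrans g + 1000 * δ ≤ L) :
    QuasiConvexSet (100 * δ) {x : X | dist (g x) x ≤ L} := by
  intro x hx y hy γ hγ p hp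
  have h1 := displacement_quasiconvex δ hδ hgeo hhyp g L x y hx hy γ hγ p hp
  by_cases hpL : dist (g p) p ≤ L
  · exact ⟨p, hpL, by rw [dist_self]; linarith⟩
  · push Not at hpL
    haveI : Nonempty X := ⟨p⟩
    obtain ⟨q, hq⟩ := exists_lt_of_ciInf_lt
      (show (⨅ p : X, dist p (g p)) < minTrans g + δ from by
        show minTrans g < _
        linarith)
    rw [dist_comm] at hq
    obtain ⟨a, h2, h3⟩ := displacement_decrease δ hδ hgeo hhyp g p q (by linarith)
    exact ⟨a, show dist (g a) a ≤ L by linarith, h2⟩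
end

section
/- Let g be an isometry of finite order N of a δ-hyperbolic geodesic metric space X (with δ > 0). Then the set MM(g) = ⋃_{0 < n < N} M(g^n) is 101δ-quasi-convex. -/
/-- The coarse minimizing set `M(g) = X(g, min(g) + 1000δ)`. -/
noncomputable def minSet {X : Type} [MetricSpace X] (δ : ℝ) (g : X ≃ᵢ X) : Set X :=
  {x : X | dist (g x) x ≤ minTrans g + 1000 * δ}

/-- For `g` of finite order `N`, `MM(g) = ⋃_{0 < n < N} M(gⁿ)`. -/
noncomputable def minSetUnion {X : Type} [MetricSpace X] (δ : ℝ) (g : X ≃ᵢ X)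
    (N : ℕ) : Set X :=
  ⋃ n ∈ Set.Ioo 0 N, minSet δ (g ^ n)


theorem geo_split {X : Type} [MetricSpace X] {x y : X} {γ : ℝ → X}
    (h : IsGeodesicFrom x y γ) {p : X} (hp : p ∈ geoImage x y γ) :
    dist x p + dist p y = dist x y := by
  obtain ⟨t, ht, rfl⟩ := hp
  obtain ⟨h0, h1, h2⟩ := h
  have a := h2 0 ⟨le_rfl, dist_nonneg⟩ t ht
  have b := h2 t ht (dist x y) ⟨dist_nonneg, le_rfl⟩
  rw [h0, zero_sub, abs_neg, abs_of_nonneg ht.1] at a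
  rw [h1, abs_sub_comm, abs_of_nonneg (by linarith [ht.2])] at b
  linarith

/-- `p` lies between `x` and `c`, and distances to `p` satisfy the coarse tree inequality. -/
def GoodPt {X : Type} [MetricSpace X] (δ : ℝ) (x c p : X) : Prop :=
  dist x p + dist p c = dist x c ∧
    ∀ w, dist w p ≤ dist w x - dist x p + 2 * δ ∨ dist w p ≤ dist w c - dist p c + 2 * δ

theorem GoodPt.swap {X : Type} [MetricSpace X] {δ : ℝ} {x c p : X} (h : GoodPt δ x c p) :
    GoodPt δ c x p := by
  refine ⟨by have := h.1; rw [dist_comm c p, dist_comm p x, dist_comm c x]; linarith, fun w => ?_⟩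
  rw [dist_comm c p, dist_comm p x]
  exact (h.2 w).symm

theorem goodPt_of_geo {X : Type} [MetricSpace X] {δ : ℝ}
    (hgeo : IsGeodesicSpace X) (hhyp : IsDeltaHyperbolic X δ) {x c p : X} {γ : ℝ → X}
    (h : IsGeodesicFrom x c γ) (hp : p ∈ geoImage x c γ) : GoodPt δ x c p := by
  refine ⟨geo_split h hp, fun w => ?_⟩
  obtain ⟨γ₁, h₁⟩ := hgeo x w
  obtain ⟨γ₂, h₂⟩ := hgeo w c
  obtain ⟨q, hq | hq, hd⟩ := hhyp x w c γ₁ γ₂ γ h₁ h₂ h p hp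
  · left
    have e := geo_split h₁ hq
    have := dist_triangle w q p
    have := dist_triangle x q p
    rw [dist_comm q p, dist_comm w q] at *
    rw [dist_comm w x]
    linarith
  · right
    have e := geo_split h₂ hq
    have := dist_triangle w q p
    have := dist_triangle p q c
    rw [dist_comm q p] at *
    linarith

theorem exists_center {X : Type} [MetricSpace X] (δ : ℝ) (hδ : 0 < δ)
    (hgeo : IsGeodesicSpace X) (hhyp : IsDeltaHyperbolic X δ)
    (g : X ≃ᵢ X) (hg : IsOfFinOrder g) (x₀ : X) :
    ∃ c : X, ∀ n : ℕ, dist c ((g ^ n) c) ≤ 6 * δ := by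
  let S : Set ℝ := {ρ | ∃ z : X, ∀ f ∈ Subgroup.zpowers g, dist z (f x₀) ≤ ρ}
  have hfin : (Subgroup.zpowers g : Set (X ≃ᵢ X)).Finite := finite_zpowers.2 hg
  have hne : S.Nonempty := by
    obtain ⟨B, hB⟩ := (hfin.image (fun f : X ≃ᵢ X => dist x₀ (f x₀))).bddAbove
    exact ⟨B, x₀, fun f hf => hB ⟨f, hf, rfl⟩⟩
  have hbdd : BddBelow S := by
    refine ⟨0, ?_⟩
    rintro ρ ⟨z, hz⟩
    exact dist_nonneg.trans (hz 1 (one_mem _))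
  obtain ⟨ρ, ⟨c, hc⟩, hρ⟩ := exists_lt_of_csInf_lt hne (lt_add_of_pos_right (sInf S) hδ)
  refine ⟨c, fun n => ?_⟩
  obtain ⟨γ, hγ⟩ := hgeo c ((g ^ n) c)
  set D := dist c ((g ^ n) c) with hD
  have hD0 : 0 ≤ D := dist_nonneg
  have hm : γ (D / 2) ∈ geoImage c ((g ^ n) c) γ := ⟨D / 2, ⟨by linarith, by rw [← hD]; linarith⟩, rfl⟩
  have hgood := goodPt_of_geo hgeo hhyp hγ hm
  have hhalf : dist c (γ (D / 2)) = D / 2 := by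
    have := hγ.2.2 0 ⟨le_rfl, hD0⟩ (D / 2) ⟨by linarith, by rw [← hD]; linarith⟩
    rw [hγ.1, zero_sub, abs_neg, abs_of_nonneg (by linarith)] at this
    exact this
  have hhalf2 := hgood.1
  rw [← hD] at hhalf2
  have hmem : ρ - D / 2 + 2 * δ ∈ S := by
    refine ⟨γ (D / 2), fun f hf => ?_⟩
    rw [dist_comm]
    have h1 := hc f hf
    have h2 : dist (f x₀) ((g ^ n) c) ≤ ρ := by
      have := hc ((g ^ n)⁻¹ * f) (mul_mem (inv_mem (pow_mem (Subgroup.mem_zpowers g) n)) hf)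
      rw [← (g ^ n).isometry.dist_eq, ← IsometryEquiv.mul_apply, mul_inv_cancel_left, dist_comm] at this
      exact this
    rw [dist_comm] at h1
    rcases hgood.2 (f x₀) with h | h <;> linarith
  have := csInf_le hbdd hmem
  linarith

theorem near_of_goodPt {X : Type} [MetricSpace X] {δ : ℝ} (hδ : 0 < δ)
    (h : X ≃ᵢ X) {x c p : X} (hc : dist c (h c) ≤ 6 * δ) (hx : x ∈ minSet δ h)
    (hp : GoodPt δ x c p) : ∃ a ∈ minSet δ h, dist p a ≤ 100 * δ := by
  have hbdd : BddBelow (Set.range fun p : X => dist p (h p)) :=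
    ⟨0, by rintro _ ⟨p, rfl⟩; exact dist_nonneg⟩
  have hle : minTrans h ≤ 6 * δ := (ciInf_le hbdd c).trans hc
  have h0 : 0 ≤ minTrans h := Real.iInf_nonneg fun p => dist_nonneg
  by_cases hs : dist x p ≤ 100 * δ
  · exact ⟨x, hx, by rwa [dist_comm]⟩
  push Not at hs
  refine ⟨p, ?_, by rw [dist_self]; positivity⟩
  have hL : dist (h x) x ≤ minTrans h + 1000 * δ := hx
  change dist (h p) p ≤ minTrans h + 1000 * δ
  have e1 : dist (h.symm x) p = dist x (h p) := by
    rw [← h.isometry.dist_eq, h.apply_symm_apply]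
  have e2 : dist (h.symm x) x = dist x (h x) := by
    rw [← h.isometry.dist_eq, h.apply_symm_apply]
  have e3 : dist (h.symm x) c = dist x (h c) := by
    rw [← h.isometry.dist_eq, h.apply_symm_apply]
  have t1 := dist_triangle x c (h c)
  have t2 := dist_triangle (h p) (h c) c
  rw [h.isometry.dist_eq, dist_comm (h c) c] at t2
  have k := hp.1
  have A := hp.2 (h p)
  have B := hp.2 (h.symm x)
  rw [e1, e2, e3, dist_comm x (h x), dist_comm x (h p)] at B
  rcases A with A | A
  · rcases B with B | B <;> linarith
  · linarith

theorem minSetUnion_quasiconvex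
    {X : Type} [MetricSpace X] (δ : ℝ) (hδ : 0 < δ)
    (hgeo : IsGeodesicSpace X) (hhyp : IsDeltaHyperbolic X δ)
    (g : X ≃ᵢ X) (N : ℕ) (hN : 0 < N) (hord : orderOf g = N) :
    QuasiConvexSet (101 * δ) (minSetUnion δ g N) := by
  intro x hx y hy γ hγ p hp
  obtain ⟨c, hc⟩ := exists_center δ hδ hgeo hhyp g (orderOf_pos_iff.1 (hord ▸ hN)) x
  have key : ∀ z ∈ minSetUnion δ g N, ∀ q, GoodPt δ z c q →
      ∃ a ∈ minSetUnion δ g N, dist q a ≤ 100 * δ := by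
    intro z hz q hq
    simp only [minSetUnion, Set.mem_iUnion] at hz ⊢
    obtain ⟨n, hn, hz⟩ := hz
    obtain ⟨a, ha, hd⟩ := near_of_goodPt hδ (g ^ n) (hc n) hz hq
    exact ⟨a, ⟨n, hn, ha⟩, hd⟩
  obtain ⟨γ₁, h₁⟩ := hgeo x c
  obtain ⟨γ₂, h₂⟩ := hgeo c y
  obtain ⟨q, hq, hd⟩ := hhyp x c y γ₁ γ₂ γ h₁ h₂ hγ p hp
  have : ∃ a ∈ minSetUnion δ g N, dist q a ≤ 100 * δ := by
    rcases hq with hq | hq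
    · exact key x hx q (goodPt_of_geo hgeo hhyp h₁ hq)
    · exact key y hy q (goodPt_of_geo hgeo hhyp h₂ hq).swap
  obtain ⟨a, ha, hda⟩ := this
  exact ⟨a, ha, by linarith [dist_triangle p q a]⟩
end

section
/- Let μ be a real number satisfying μ³ − 6μ² + 5μ − 1 = 0. Then the polynomial x³ − 6x² + 5x − 1 is irreducible over ℚ, μ² − 5μ + 3 ≠ 0, the identity μ·(3μ² − 17μ + 10) = μ² − 5μ + 3 holds (so that μ/(μ² − 5μ + 3) = 1/(3μ² − 17μ + 10)), and the number μ/(μ² − 5μ + 3) is irrational. -/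
open Polynomial

lemma no_rat_root (q : ℚ) : q ^ 3 - 6 * q ^ 2 + 5 * q - 1 ≠ 0 := by
  intro h
  have hd : (q.den : ℚ) ≠ 0 := by exact_mod_cast q.den_ne_zero
  have hz : (q.num : ℚ) ^ 3 - 6 * q.num ^ 2 * q.den + 5 * q.num * q.den ^ 2 - q.den ^ 3 = 0 := by
    have e : (q.num : ℚ) = q * q.den := (Rat.mul_den_eq_num q).symm
    rw [e]
    linear_combination (q.den : ℚ) ^ 3 * h
  have hz' : (q.num) ^ 3 - 6 * q.num ^ 2 * q.den + 5 * q.num * (q.den : ℤ) ^ 2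
      - (q.den : ℤ) ^ 3 = 0 := by exact_mod_cast hz
  have hc : IsCoprime q.num (q.den : ℤ) := Rat.isCoprime_num_den q
  generalize q.num = n at *
  generalize (q.den : ℤ) = d at *
  have hp := congrArg Even hz'
  simp only [Even.zero, eq_iff_iff, iff_true] at hp
  have h5 : ¬ Even (5 : ℤ) := by decide
  have h6 : Even (6 : ℤ) := by decide
  simp only [Int.even_sub, Int.even_add, Int.even_mul, Int.even_pow] at hp
  have hn : Even n ∧ Even d := by
    by_cases h1 : Even n <;> by_cases h2 : Even d <;> simp_all
  have := hc.isUnit_of_dvd' hn.1.two_dvd hn.2.two_dvd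
  revert this
  decide

theorem mu_cross_ratio_irrational
    (μ : ℝ) (hμ : μ ^ 3 - 6 * μ ^ 2 + 5 * μ - 1 = 0) :
    Irreducible (X ^ 3 - 6 * X ^ 2 + 5 * X - 1 : ℚ[X]) ∧
    μ ^ 2 - 5 * μ + 3 ≠ 0 ∧
    μ * (3 * μ ^ 2 - 17 * μ + 10) = μ ^ 2 - 5 * μ + 3 ∧
    μ / (μ ^ 2 - 5 * μ + 3) = 1 / (3 * μ ^ 2 - 17 * μ + 10) ∧
    Irrational (μ / (μ ^ 2 - 5 * μ + 3)) := by
  have hirr : ∀ q : ℚ, (q : ℝ) ≠ μ := by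
    rintro q rfl
    exact no_rat_root q (by exact_mod_cast hμ)
  have hne : μ ^ 2 - 5 * μ + 3 ≠ 0 := by
    intro h
    apply hirr (2 / 3)
    push_cast
    linear_combination (1 / 3) * (hμ - (μ - 1) * h)
  have hid : μ * (3 * μ ^ 2 - 17 * μ + 10) = μ ^ 2 - 5 * μ + 3 := by
    linear_combination 3 * hμ
  have hμ0 : μ ≠ 0 := by
    rintro rfl
    norm_num at hμ
  have hk : 3 * μ ^ 2 - 17 * μ + 10 ≠ 0 := by
    intro h
    rw [h, mul_zero] at hid
    exact hne hid.symm
  have heq : μ / (μ ^ 2 - 5 * μ + 3) = 1 / (3 * μ ^ 2 - 17 * μ + 10) := by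
    rw [← hid]
    field_simp
  refine ⟨?_, hne, hid, heq, ?_⟩
  · have e : (X ^ 3 - 6 * X ^ 2 + 5 * X - 1 : ℚ[X])
        = C 1 * X ^ 3 + C (-6) * X ^ 2 + C 5 * X + C (-1) := by
      simp only [map_neg, map_one, show (C 6 : ℚ[X]) = 6 from rfl, show (C 5 : ℚ[X]) = 5 from rfl]
      ring
    have hdeg : (X ^ 3 - 6 * X ^ 2 + 5 * X - 1 : ℚ[X]).natDegree = 3 := by
      rw [e]; exact natDegree_cubic one_ne_zero
    rw [irreducible_iff_roots_eq_zero_of_degree_le_three (by omega) (by omega)]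
    refine Multiset.eq_zero_of_forall_notMem fun q hq => no_rat_root q ?_
    have := (mem_roots'.1 hq).2
    simpa [IsRoot] using this
  · rw [heq]
    rintro ⟨r, hr⟩
    have hs : 3 * μ ^ 2 - 17 * μ + 10 = ((r⁻¹ : ℚ) : ℝ) := by
      push_cast
      rw [hr]
      simp
    generalize r⁻¹ = s at hs
    -- reduce the cubic modulo the quadratic: a linear relation over ℚ
    have hlin : (3 * (s : ℝ) - 2) * μ = s - 1 := by
      linear_combination 9 * hμ - (3 * μ - 1) * hs
    by_cases h : (3 * (s : ℝ) - 2) = 0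
    · rw [h, zero_mul] at hlin
      linarith
    · apply hirr ((s - 1) / (3 * s - 2))
      push_cast
      rw [← hlin]
      field_simp
end
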